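/- arXiv:1003.5461 — 12 statements merged into one kernel-verified Lean document; each statement's English description precedes it below -/
import Mathlib

section
/- Let d ≥ 1, let p_1 < p_2 < … < p_d be the first d prime numbers, let N ≥ 2 be an integer, let C > 1 be a real number, and let A_1 be Adleman's 1-norm Prime Number Lattice basis matrix. Let z ∈ ℤ^{d+1} be a vector with strictly negative last coordinate, set γ = |z_{d+1}|, u = ∏_{1≤i≤d, z_i>0} p_i^{z_i} and k = ∏_{1≤i≤d, z_i<0} p_i^{−z_i}. Let σ ≥ 1 be a real number. If ‖A_1 z‖_1 ≤ 2 ln C + 2σ ln p_d − γ ln N, then |u − k N^γ| ≤ p_d^σ. -/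
open Finset Matrix

/-- For `0 < q < 1 < C`, the product `C * q ^ ((C - 1) / 2) * (1 - q)` is at most `1`, in
logarithmic form. -/
lemma log_add_mul_log_add_log_one_sub_nonpos {C q : ℝ} (hC : 1 < C) (hq : 0 < q) (hq1 : q < 1) :
    Real.log C + (C - 1) / 2 * Real.log q + Real.log (1 - q) ≤ 0 := by
  have hC0 : 0 < C - 1 := by linarith
  have hC1 : 0 < C + 1 := by linarith
  have hq2 : 0 < 1 - q := by linarith
  have h₁ := Real.log_le_sub_one_of_pos (show 0 < q * ((C + 1) / (C - 1)) by positivity)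
  have h₂ := Real.log_le_sub_one_of_pos (show 0 < (1 - q) * ((C + 1) / 2) by positivity)
  have h₃ := Real.log_le_sub_one_of_pos (show 0 < C / ((C + 1) / 2) by positivity)
  have h₄ := Real.log_le_sub_one_of_pos (show 0 < ((C + 1) / (C - 1))⁻¹ by positivity)
  rw [Real.log_mul (by positivity) (by positivity)] at h₁ h₂
  rw [Real.log_div (by positivity) (by positivity)] at h₃
  rw [Real.log_inv] at h₄
  have h₅ := mul_le_mul_of_nonneg_left (add_le_add h₁ h₄) (show 0 ≤ (C - 1) / 2 by positivity)
  have h₆ : (C - 1) / 2 * (q * ((C + 1) / (C - 1)) - 1 + (((C + 1) / (C - 1))⁻¹ - 1))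
      + ((1 - q) * ((C + 1) / 2) - 1) + (C / ((C + 1) / 2) - 1) = 0 := by
    field_simp
    ring
  linarith

/-- Two positive reals with small weighted sum of logarithmic size and logarithmic distance are
close. -/
lemma abs_sub_le_exp_of_log_add_log_add_mul_abs_le {C B x y : ℝ} (hC : 1 < C) (hx : 0 < x)
    (hy : 0 < y)
    (h : Real.log x + Real.log y + C * |Real.log x - Real.log y| ≤ 2 * Real.log C + 2 * B) :
    |x - y| ≤ Real.exp B := by
  wlog hxy : y ≤ x generalizing x y
  · rw [abs_sub_comm]
    exact this hy hx (by rwa [abs_sub_comm, add_comm (Real.log y)]) (le_of_not_ge hxy)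
  rcases hxy.eq_or_lt with rfl | hlt
  · simpa using (Real.exp_pos B).le
  rw [abs_of_nonneg (sub_nonneg.2 (Real.log_le_log hy hxy))] at h
  rw [abs_of_pos (sub_pos.2 hlt), ← Real.log_le_iff_le_exp (sub_pos.2 hlt)]
  have hq1 : y / x < 1 := (div_lt_one hx).2 hlt
  have key := log_add_mul_log_add_log_one_sub_nonpos hC (div_pos hy hx) hq1
  have hsub : x - y = x * (1 - y / x) := by field_simp
  rw [hsub, Real.log_mul hx.ne' (sub_pos.2 hq1).ne']
  rw [Real.log_div hy.ne' hx.ne'] at key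
  linarith

/-- The logarithm of the part of `∏ p i ^ z i` with positive exponents. -/
lemma log_prod_ite_pow_toNat {ι : Type*} [Fintype ι] (p : ι → ℕ) (hp : ∀ i, 0 < p i) (z : ι → ℤ) :
    Real.log ((∏ i, if 0 < z i then p i ^ (z i).toNat else 1 : ℕ) : ℝ) =
      ∑ i, max (z i : ℝ) 0 * Real.log (p i) := by
  have hp' (i : ι) : (p i : ℝ) ≠ 0 := by exact_mod_cast (hp i).ne'
  rw [Nat.cast_prod, Real.log_prod]
  · refine sum_congr rfl fun i _ ↦ ?_
    split_ifs with hi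
    · have hcast : ((z i).toNat : ℝ) = z i := by exact_mod_cast Int.toNat_of_nonneg hi.le
      rw [max_eq_left (by exact_mod_cast hi.le), Nat.cast_pow, Real.log_pow, hcast]
    · rw [max_eq_right (by exact_mod_cast not_lt.1 hi)]
      simp
  · intro i _
    split_ifs
    · simpa using fun h ↦ absurd h (hp i).ne'
    · simp

lemma prod_ite_pow_toNat_pos {ι : Type*} [Fintype ι] (p : ι → ℕ) (hp : ∀ i, 0 < p i) (z : ι → ℤ) :
    0 < ∏ i, if 0 < z i then p i ^ (z i).toNat else 1 := by
  refine prod_pos fun i _ ↦ ?_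
  split_ifs
  · exact pow_pos (hp i) _
  · exact one_pos

/-- Theorem 1 (`th:svp-capture`): for Adleman's 1-norm Prime Number Lattice basis `A₁`,
if `‖A₁ z‖₁ ≤ 2 ln C + 2 σ ln p_d − γ ln N` for a vector `z` with strictly negative last
coordinate, then `|u − k N^γ| ≤ p_d^σ`. -/
theorem adleman_svp_capture
    (d : ℕ) (hd : 1 ≤ d) (N : ℕ) (hN : 2 ≤ N) (C : ℝ) (hC : 1 < C)
    (A : Matrix (Fin (d + 1)) (Fin (d + 1)) ℝ)
    (hA : ∀ i j, A i j =
      if (i : ℕ) = d then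
        (if (j : ℕ) = d then C * Real.log N else C * Real.log (Nat.nth Nat.Prime (j : ℕ)))
      else if (i : ℕ) = (j : ℕ) then Real.log (Nat.nth Nat.Prime (j : ℕ)) else 0)
    (z : Fin (d + 1) → ℤ) (hz : z (Fin.last d) < 0)
    (γ : ℕ) (hγ : γ = (z (Fin.last d)).natAbs)
    (u : ℕ) (hu : u = ∏ i : Fin d,
      if 0 < z i.castSucc then Nat.nth Nat.Prime (i : ℕ) ^ (z i.castSucc).toNat else 1)
    (k : ℕ) (hk : k = ∏ i : Fin d,
      if z i.castSucc < 0 then Nat.nth Nat.Prime (i : ℕ) ^ (-z i.castSucc).toNat else 1)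
    (σ : ℝ) (hσ : 1 ≤ σ)
    (h : ∑ i, |A.mulVec (fun j => (z j : ℝ)) i| ≤
      2 * Real.log C + 2 * σ * Real.log (Nat.nth Nat.Prime (d - 1)) - γ * Real.log N) :
    |(u : ℝ) - k * (N : ℝ) ^ γ| ≤ (Nat.nth Nat.Prime (d - 1) : ℝ) ^ σ := by
  set p : Fin d → ℕ := fun i ↦ Nat.nth Nat.Prime (i : ℕ) with hp_def
  have hp (i : Fin d) : 0 < p i := (Nat.prime_nth_prime _).pos
  have hP : 0 < (Nat.nth Nat.Prime (d - 1) : ℝ) := by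
    exact_mod_cast (Nat.prime_nth_prime _).pos
  have hN0 : (0 : ℝ) < N := by exact_mod_cast (by omega : 0 < N)
  have hk' : k = ∏ i, if 0 < -z (Fin.castSucc i) then p i ^ (-z i.castSucc).toNat else 1 := by
    simpa only [neg_pos] using hk
  have hu0 : (0 : ℝ) < u := by
    exact_mod_cast hu ▸ prod_ite_pow_toNat_pos p hp fun i ↦ z i.castSucc
  have hk0 : (0 : ℝ) < k := by
    exact_mod_cast hk' ▸ prod_ite_pow_toNat_pos p hp fun i ↦ -z i.castSucc
  have hlogu : Real.log u = ∑ i : Fin d, max (z i.castSucc : ℝ) 0 * Real.log (p i) :=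
    hu ▸ log_prod_ite_pow_toNat p hp fun i ↦ z i.castSucc
  have hlogk : Real.log k = ∑ i : Fin d, max (-z i.castSucc : ℝ) 0 * Real.log (p i) := by
    have := log_prod_ite_pow_toNat p hp fun i ↦ -z i.castSucc
    rw [← hk'] at this
    simpa using this
  have hγz : (γ : ℝ) = -(z (Fin.last d) : ℝ) := by
    have : (γ : ℤ) = -z (Fin.last d) := by omega
    exact_mod_cast this
  have hlogV : Real.log (k * (N : ℝ) ^ γ) = Real.log k + γ * Real.log N := by
    rw [Real.log_mul hk0.ne' (pow_pos hN0 _).ne', Real.log_pow]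
  have hrow (i : Fin d) : |A.mulVec (fun j ↦ (z j : ℝ)) i.castSucc| =
      max (z i.castSucc : ℝ) 0 * Real.log (p i) + max (-z i.castSucc : ℝ) 0 * Real.log (p i) := by
    have hlog : 0 ≤ Real.log (p i) := Real.log_natCast_nonneg _
    have hmul : A.mulVec (fun j ↦ (z j : ℝ)) i.castSucc = Real.log (p i) * z i.castSucc := by
      rw [Matrix.mulVec, dotProduct, sum_eq_single i.castSucc]
      · simp [hA, i.isLt.ne, hp_def]
      · intro j _ hj
        have : (i : ℕ) ≠ j := fun h ↦ hj (Fin.ext (by simpa using h.symm))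
        simp [hA, i.isLt.ne, this]
      · simp
    rw [hmul, abs_mul, abs_of_nonneg hlog, ← add_mul, mul_comm]
    congr 1
    rcases le_total (z i.castSucc : ℝ) 0 with hi | hi <;> simp [hi, abs_of_nonpos, abs_of_nonneg]
  have hlast : A.mulVec (fun j ↦ (z j : ℝ)) (Fin.last d) =
      C * (Real.log u - Real.log (k * (N : ℝ) ^ γ)) := by
    rw [hlogV, hlogu, hlogk, hγz, Matrix.mulVec, dotProduct, Fin.sum_univ_castSucc]
    have hsum : ∑ i : Fin d, A (Fin.last d) i.castSucc * (z i.castSucc : ℝ) =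
        C * (∑ i : Fin d, max (z i.castSucc : ℝ) 0 * Real.log (p i) -
          ∑ i : Fin d, max (-z i.castSucc : ℝ) 0 * Real.log (p i)) := by
      rw [← sum_sub_distrib, mul_sum]
      refine sum_congr rfl fun i _ ↦ ?_
      have hmax : max (z i.castSucc : ℝ) 0 - max (-z i.castSucc : ℝ) 0 = z i.castSucc := by
        rcases le_total (z i.castSucc : ℝ) 0 with hi | hi <;> simp [hi]
      rw [← sub_mul, hmax]
      simp only [hA, Fin.val_last, Fin.val_castSucc, if_true, if_neg i.isLt.ne, hp_def]
      ring
    rw [hsum]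
    simp only [hA, Fin.val_last, if_true]
    ring
  rw [Real.rpow_def_of_pos hP]
  refine abs_sub_le_exp_of_log_add_log_add_mul_abs_le hC hu0 (mul_pos hk0 (pow_pos hN0 _)) ?_
  rw [Fin.sum_univ_castSucc, sum_congr rfl fun i _ ↦ hrow i, sum_add_distrib, ← hlogu, ← hlogk,
    hlast, abs_mul, abs_of_pos (by linarith : 0 < C)] at h
  linarith
end

section
/- Let d ≥ 1, let p_1 < p_2 < … < p_d be the first d prime numbers, let N ≥ 2 be an integer, let C > 1 be a real number, let S_1 be Schnorr's 1-norm Prime Number Lattice basis matrix and let t = C ln N·e_{d+1} ∈ ℝ^{d+1} be the target vector. Let z ∈ ℤ^d, and set u = ∏_{1≤i≤d, z_i>0} p_i^{z_i} and k = ∏_{1≤i≤d, z_i<0} p_i^{−z_i}. Let σ ≥ 1 be a real number. If ‖S_1 z − t‖_1 ≤ 2 ln C + 2σ ln p_d − ln N, then |u − k N| ≤ p_d^σ. -/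
open Finset Matrix

/-- For `0 ≤ x` and `1 ≤ C`, one has `2 C sinh x ≤ exp (C x)`. -/
theorem mul_exp_sub_exp_neg_le {C x : ℝ} (hC : 1 ≤ C) (hx : 0 ≤ x) :
    C * (Real.exp x - Real.exp (-x)) ≤ Real.exp (C * x) := by
  rcases le_total x 1 with h1 | h1
  · have hconv : Real.exp x ≤ (1 - x) + x * Real.exp 1 := by
      have := convexOn_exp.2 (Set.mem_univ 0) (Set.mem_univ 1) (sub_nonneg.2 h1) hx (by ring)
      simpa using this
    have hneg := Real.add_one_le_exp (-x)
    have hlin : Real.exp x - Real.exp (-x) ≤ x * Real.exp 1 := by linarith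
    calc C * (Real.exp x - Real.exp (-x)) ≤ C * (x * Real.exp 1) := by gcongr
      _ = (C * x - 1 + 1) * Real.exp 1 := by ring
      _ ≤ Real.exp (C * x - 1) * Real.exp 1 := by
        gcongr
        exact Real.add_one_le_exp _
      _ = Real.exp (C * x) := by rw [← Real.exp_add]; ring_nf
  · have hle : C ≤ Real.exp ((C - 1) * x) := by
      have := Real.add_one_le_exp ((C - 1) * x)
      nlinarith
    calc C * (Real.exp x - Real.exp (-x)) ≤ C * Real.exp x := by
          gcongr
          linarith [Real.exp_pos (-x)]
      _ ≤ Real.exp ((C - 1) * x) * Real.exp x := by gcongr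
      _ = Real.exp (C * x) := by rw [← Real.exp_add]; ring_nf

theorem exp_sub_exp_le_of_add_mul_sub_le {C A B L : ℝ} (hC : 1 ≤ C) (hBA : B ≤ A)
    (h : A + B + C * (A - B) ≤ 2 * Real.log C + 2 * L) :
    Real.exp A - Real.exp B ≤ Real.exp L := by
  have hC0 : 0 < C := by linarith
  have key := mul_exp_sub_exp_neg_le hC (x := (A - B) / 2) (by linarith)
  refine le_of_mul_le_mul_left ?_ hC0
  calc C * (Real.exp A - Real.exp B)
      = Real.exp ((A + B) / 2) *
          (C * (Real.exp ((A - B) / 2) - Real.exp (-((A - B) / 2)))) := by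
        rw [mul_left_comm, mul_sub (Real.exp _), ← Real.exp_add, ← Real.exp_add]
        ring_nf
    _ ≤ Real.exp ((A + B) / 2) * Real.exp (C * ((A - B) / 2)) := by gcongr
    _ = Real.exp ((A + B) / 2 + C * ((A - B) / 2)) := (Real.exp_add _ _).symm
    _ ≤ Real.exp (Real.log C + L) := Real.exp_le_exp.2 (by linarith)
    _ = C * Real.exp L := by rw [Real.exp_add, Real.exp_log hC0]

theorem abs_sub_le_exp_of_log_add_log_le {C a b L : ℝ} (hC : 1 ≤ C) (ha : 0 < a) (hb : 0 < b)
    (h : Real.log a + Real.log b + C * |Real.log a - Real.log b| ≤ 2 * Real.log C + 2 * L) :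
    |a - b| ≤ Real.exp L := by
  wlog hab : b ≤ a generalizing a b
  · rw [abs_sub_comm]
    refine this hb ha ?_ (le_of_not_ge hab)
    rwa [abs_sub_comm, add_comm (Real.log b)]
  have hlog := Real.log_le_log hb hab
  rw [abs_of_nonneg (sub_nonneg.2 hlog)] at h
  rw [abs_of_nonneg (sub_nonneg.2 hab)]
  simpa [Real.exp_log, ha, hb] using exp_sub_exp_le_of_add_mul_sub_le hC hlog h

/-- Theorem 2 (`th:cvp-capture`): for Schnorr's 1-norm Prime Number Lattice basis `S₁` and
target vector `t`, if `‖S₁ z − t‖₁ ≤ 2 ln C + 2 σ ln p_d − ln N`, then `|u − k N| ≤ p_d^σ`. -/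
theorem schnorr_cvp_capture
    (d : ℕ) (hd : 1 ≤ d) (N : ℕ) (hN : 2 ≤ N) (C : ℝ) (hC : 1 < C)
    (S : Matrix (Fin (d + 1)) (Fin d) ℝ)
    (hS : ∀ i j, S i j =
      if (i : ℕ) = (j : ℕ) then Real.log (Nat.nth Nat.Prime (j : ℕ))
      else if (i : ℕ) = d then C * Real.log (Nat.nth Nat.Prime (j : ℕ)) else 0)
    (t : Fin (d + 1) → ℝ) (ht : ∀ i, t i = if (i : ℕ) = d then C * Real.log N else 0)
    (z : Fin d → ℤ)
    (u : ℕ) (hu : u = ∏ i : Fin d,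
      if 0 < z i then Nat.nth Nat.Prime (i : ℕ) ^ (z i).toNat else 1)
    (k : ℕ) (hk : k = ∏ i : Fin d,
      if z i < 0 then Nat.nth Nat.Prime (i : ℕ) ^ (-z i).toNat else 1)
    (σ : ℝ) (hσ : 1 ≤ σ)
    (h : ∑ i, |(S.mulVec (fun j => (z j : ℝ)) - t) i| ≤
      2 * Real.log C + 2 * σ * Real.log (Nat.nth Nat.Prime (d - 1)) - Real.log N) :
    |(u : ℝ) - k * N| ≤ (Nat.nth Nat.Prime (d - 1) : ℝ) ^ σ := by
  have hp (n : ℕ) : 0 < Nat.nth Nat.Prime n := (Nat.prime_nth_prime n).pos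
  have hu0 : 0 < u := by
    rw [hu]
    refine Finset.prod_pos fun i _ => ?_
    split_ifs
    exacts [pow_pos (hp _) _, one_pos]
  have hk0 : 0 < k := by
    rw [hk]
    refine Finset.prod_pos fun i _ => ?_
    split_ifs
    exacts [pow_pos (hp _) _, one_pos]
  have hlogu : Real.log u =
      ∑ i : Fin d, ((max (z i) 0 : ℤ) : ℝ) * Real.log (Nat.nth Nat.Prime i) := by
    rw [hu, Nat.cast_prod, Real.log_prod]
    · refine Finset.sum_congr rfl fun i _ => ?_
      split_ifs with hz
      · rw [Nat.cast_pow, Real.log_pow, ← Int.toNat_eq_max, Int.cast_natCast]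
      · simp [max_eq_right (not_lt.1 hz)]
    · intro i _
      split_ifs
      · exact_mod_cast (pow_pos (hp _) _).ne'
      · simp
  have hlogk : Real.log k =
      ∑ i : Fin d, ((max (-z i) 0 : ℤ) : ℝ) * Real.log (Nat.nth Nat.Prime i) := by
    rw [hk, Nat.cast_prod, Real.log_prod]
    · refine Finset.sum_congr rfl fun i _ => ?_
      split_ifs with hz
      · rw [Nat.cast_pow, Real.log_pow, ← Int.toNat_eq_max, Int.cast_natCast]
      · simp [max_eq_right (neg_nonpos.2 (not_lt.1 hz))]
    · intro i _
      split_ifs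
      · exact_mod_cast (pow_pos (hp _) _).ne'
      · simp
  have hN0 : (0 : ℝ) < N := by exact_mod_cast (by omega : 0 < N)
  have hkR : (0 : ℝ) < k := by exact_mod_cast hk0
  have huR : (0 : ℝ) < u := by exact_mod_cast hu0
  have hpR : (0 : ℝ) < Nat.nth Nat.Prime (d - 1) := by exact_mod_cast hp _
  have hrow (i : Fin d) : |(S.mulVec (fun j => (z j : ℝ)) - t) i.castSucc| =
      (((max (z i) 0 : ℤ) : ℝ) + ((max (-z i) 0 : ℤ) : ℝ)) *
        Real.log (Nat.nth Nat.Prime i) := by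
    have hentry (j : Fin d) :
        S i.castSucc j = if i = j then Real.log (Nat.nth Nat.Prime j) else 0 := by
      simp [hS, i.isLt.ne, Fin.ext_iff]
    have hlog : 0 ≤ Real.log (Nat.nth Nat.Prime i) := Real.log_natCast_nonneg _
    have habs : max (z i) 0 + max (-z i) 0 = |z i| := by
      rcases le_total 0 (z i) with hz | hz <;> simp [hz, abs_of_nonneg, abs_of_nonpos]
    rw [← Int.cast_add, habs, Int.cast_abs]
    simp [Matrix.mulVec, dotProduct, hentry, ht, i.isLt.ne, abs_mul, abs_of_nonneg hlog, mul_comm]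
  have hlast : (S.mulVec (fun j => (z j : ℝ)) - t) (Fin.last d) =
      C * (Real.log u - Real.log (k * N)) := by
    have hentry (j : Fin d) : S (Fin.last d) j = C * Real.log (Nat.nth Nat.Prime j) := by
      simp [hS, j.isLt.ne']
    have hsplit : Real.log u - Real.log k =
        ∑ i : Fin d, (z i : ℝ) * Real.log (Nat.nth Nat.Prime i) := by
      rw [hlogu, hlogk, ← Finset.sum_sub_distrib]
      refine Finset.sum_congr rfl fun i _ => ?_
      rw [← sub_mul, ← Int.cast_sub]
      congr 2
      omega
    rw [Real.log_mul hkR.ne' hN0.ne', ← sub_sub, hsplit, mul_sub, Finset.mul_sum]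
    simp [Matrix.mulVec, dotProduct, hentry, ht, mul_comm, mul_left_comm]
  rw [Fin.sum_univ_castSucc, hlast, abs_mul, abs_of_pos (by linarith : 0 < C)] at h
  simp only [hrow, add_mul, Finset.sum_add_distrib] at h
  rw [← hlogu, ← hlogk] at h
  rw [Real.rpow_def_of_pos hpR]
  refine abs_sub_le_exp_of_log_add_log_le hC.le huR (mul_pos hkR hN0) ?_
  have := Real.log_mul hkR.ne' hN0.ne'
  linarith
end

section
/- Let d ≥ 1, let p_1 < p_2 < … < p_d be the first d prime numbers, let C > 0 and p ≥ 1 be real numbers, and let S_p be Schnorr's p-norm Prime Number Lattice basis matrix. Then the volume of the lattice generated by the columns of S_p satisfies √|det(S_pᵀ S_p)| = √(1 + C² ∑_{i=1}^d (ln p_i)^{2−2/p}) · ∏_{i=1}^d (ln p_i)^{1/p}. -/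
open Finset Matrix

/-- The determinant of a symmetric rank-one perturbation of the square of an invertible
diagonal matrix. -/
theorem det_diagonal_sq_add_vecMulVec {n : Type*} [Fintype n] [DecidableEq n]
    (a v : n → ℝ) (ha : ∀ i, a i ≠ 0) :
    (Matrix.of fun i j => (if i = j then a i ^ 2 else 0) + v i * v j).det =
      (1 + ∑ i, (v i / a i) ^ 2) * (∏ i, a i) ^ 2 := by
  have h : (Matrix.of fun i j => (if i = j then a i ^ 2 else 0) + v i * v j) =
      diagonal a * (1 + replicateCol Unit (fun i => v i / a i) *
        replicateRow Unit (fun i => v i / a i)) * diagonal a := by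
    ext i j
    have hi := ha i
    have hj := ha j
    rw [mul_diagonal, diagonal_mul]
    by_cases hij : i = j
    · subst hij
      simp [Matrix.mul_apply]
      field_simp
    · simp [Matrix.mul_apply, hij]
      field_simp
  rw [h, det_mul, det_mul, det_diagonal, det_one_add_replicateCol_mul_replicateRow]
  simp only [dotProduct, ← sq]
  ring

/-- The volume of the `p`-norm Schnorr lattice:
`√|det(S_pᵀ S_p)| = √(1 + C² ∑ (ln p_i)^{2−2/p}) · ∏ (ln p_i)^{1/p}`. -/
theorem schnorr_lattice_volume
    (d : ℕ) (hd : 1 ≤ d) (C p : ℝ) (hC : 0 < C) (hp : 1 ≤ p)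
    (S : Matrix (Fin (d + 1)) (Fin d) ℝ)
    (hS : ∀ i j, S i j =
      if (i : ℕ) = (j : ℕ) then Real.log (Nat.nth Nat.Prime (j : ℕ)) ^ (1 / p)
      else if (i : ℕ) = d then C * Real.log (Nat.nth Nat.Prime (j : ℕ)) else 0) :
    Real.sqrt |(Sᵀ * S).det| =
      Real.sqrt (1 + C ^ 2 * ∑ i : Fin d, Real.log (Nat.nth Nat.Prime (i : ℕ)) ^ (2 - 2 / p)) *
        ∏ i : Fin d, Real.log (Nat.nth Nat.Prime (i : ℕ)) ^ (1 / p) := by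
  have hL (k : ℕ) : 0 < Real.log (Nat.nth Nat.Prime k) :=
    Real.log_pos (by exact_mod_cast (Nat.prime_nth_prime k).one_lt)
  have ha (k : ℕ) := Real.rpow_pos_of_pos (hL k) (1 / p)
  have hgram : Sᵀ * S = Matrix.of fun i j : Fin d =>
      (if i = j then (Real.log (Nat.nth Nat.Prime (i : ℕ)) ^ (1 / p)) ^ 2 else 0) +
        (C * Real.log (Nat.nth Nat.Prime (i : ℕ))) *
          (C * Real.log (Nat.nth Nat.Prime (j : ℕ))) := by
    ext i j
    rw [Matrix.mul_apply, Fin.sum_univ_castSucc]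
    simp only [transpose_apply, hS, Fin.val_castSucc, Fin.val_last, Fin.val_inj,
      (Fin.is_lt _).ne, (Fin.is_lt _).ne', if_false, if_true, of_apply]
    congr 1
    by_cases hij : i = j
    · subst hij
      simp [sq]
    · simp [hij, Ne.symm hij]
  have hsum : ∑ i : Fin d, (C * Real.log (Nat.nth Nat.Prime (i : ℕ)) /
        Real.log (Nat.nth Nat.Prime (i : ℕ)) ^ (1 / p)) ^ 2 =
      C ^ 2 * ∑ i : Fin d, Real.log (Nat.nth Nat.Prime (i : ℕ)) ^ (2 - 2 / p) := by
    rw [Finset.mul_sum]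
    refine Finset.sum_congr rfl fun i _ => ?_
    rw [Real.rpow_sub (hL i), Real.rpow_two, div_pow, mul_pow, mul_div_assoc,
      ← Real.rpow_natCast (_ ^ (1 / p)) 2, ← Real.rpow_mul (hL i).le]
    congr 3
    push_cast
    ring
  have hprod : 0 ≤ ∏ i : Fin d, Real.log (Nat.nth Nat.Prime (i : ℕ)) ^ (1 / p) :=
    Finset.prod_nonneg fun i _ => (ha i).le
  have hfac : 0 ≤ 1 + C ^ 2 * ∑ i : Fin d,
      Real.log (Nat.nth Nat.Prime (i : ℕ)) ^ (2 - 2 / p) := by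
    rw [← hsum]
    positivity
  rw [hgram, det_diagonal_sq_add_vecMulVec (fun i : Fin d => _ ^ (1 / p)) (fun i : Fin d => C * _)
    fun i => (ha i).ne', hsum, abs_of_nonneg (mul_nonneg hfac (sq_nonneg _)),
    Real.sqrt_mul hfac, Real.sqrt_sq hprod]
end

section
/- Let d ≥ 1, let p_1 < … < p_d be the first d prime numbers, let C > 0 and p ≥ 1 be reals, let b_1,…,b_d ∈ ℝ^{d+1} be the columns of Schnorr's p-norm Prime Number Lattice basis S_p, and set D_j = 1 + C² ∑_{i=1}^j (ln p_i)^{2−2/p} for 0 ≤ j ≤ d (so D_0 = 1). Then the Gram–Schmidt orthogonalization b_1^⋆,…,b_d^⋆ of b_1,…,b_d (with respect to the Euclidean inner product) satisfies, for each 1 ≤ k ≤ d: the i-th coordinate of b_k^⋆ equals −C² ln p_k (ln p_i)^{1−1/p}/D_{k−1} for i < k, equals (ln p_k)^{1/p} for i = k, equals 0 for k < i < d+1, and equals C ln p_k / D_{k−1} for i = d+1. -/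
open Finset RealInnerProductSpace

/-- The coordinates of the `j`-th Gram–Schmidt vector of the basis with diagonal entries `a j`
and entries `a j * x j` in row `d`. -/
noncomputable def arrowGSOCoord (a x D : ℕ → ℝ) (d j i : ℕ) : ℝ :=
  if i < j then -(a j * x j * x i) / D j
  else if i = j then a j
  else if i = d then a j * x j / D j
  else 0

section arrowGSOCoord

variable {a x D : ℕ → ℝ} {d j k i n : ℕ}

lemma arrowGSOCoord_of_lt (h : i < j) :
    arrowGSOCoord a x D d j i = -(a j * x j * x i) / D j := by
  simp [arrowGSOCoord, h]

lemma arrowGSOCoord_self : arrowGSOCoord a x D d j j = a j := by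
  simp [arrowGSOCoord]

lemma arrowGSOCoord_of_gt (h : j < i) (hi : i < d) : arrowGSOCoord a x D d j i = 0 := by
  simp [arrowGSOCoord, h.not_gt, h.ne', hi.ne]

lemma arrowGSOCoord_last (h : j < d) :
    arrowGSOCoord a x D d j d = a j * x j / D j := by
  simp [arrowGSOCoord, h.not_gt, h.ne']

lemma eq_one_add_sum_sq (D0 : D 0 = 1) (Ds : ∀ j, D (j + 1) = D j + x j ^ 2) (n : ℕ) :
    D n = 1 + ∑ i ∈ range n, x i ^ 2 := by
  induction n with
  | zero => simp [D0]
  | succ n ih => rw [Ds, ih, sum_range_succ, add_assoc]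

lemma sum_arrowGSOCoord_sq (D0 : D 0 = 1) (Ds : ∀ j, D (j + 1) = D j + x j ^ 2)
    (Dpos : ∀ j, 0 < D j) (hj : j < d) :
    ∑ i ∈ range (d + 1), arrowGSOCoord a x D d j i * arrowGSOCoord a x D d j i =
      a j ^ 2 * D (j + 1) / D j := by
  have h₁ : ∑ i ∈ range d, arrowGSOCoord a x D d j i * arrowGSOCoord a x D d j i =
      ∑ i ∈ range (j + 1), arrowGSOCoord a x D d j i * arrowGSOCoord a x D d j i := by
    refine (sum_subset (range_subset_range.2 hj) fun i hi hij => ?_).symm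
    rw [arrowGSOCoord_of_gt (by simpa using hij) (by simpa using hi), mul_zero]
  have h₂ : ∑ i ∈ range j, arrowGSOCoord a x D d j i * arrowGSOCoord a x D d j i =
      (a j * x j / D j) ^ 2 * (D j - 1) := by
    rw [eq_one_add_sum_sq D0 Ds j, add_sub_cancel_left, mul_sum,
      ← eq_one_add_sum_sq D0 Ds j]
    refine sum_congr rfl fun i hi => ?_
    rw [arrowGSOCoord_of_lt (by simpa using hi)]
    ring
  rw [sum_range_succ, h₁, sum_range_succ, h₂, arrowGSOCoord_self, arrowGSOCoord_last hj, Ds]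
  have := (Dpos j).ne'
  field_simp
  ring

lemma sum_mul_arrowGSOCoord_of_lt (ha : ∀ j, 0 < a j) (Ds : ∀ j, D (j + 1) = D j + x j ^ 2)
    (Dpos : ∀ j, 0 < D j) (c : ℝ) (hid : i < d) (hn : i + 1 ≤ n) :
    ∑ j ∈ range n, c * x j / (a j * D (j + 1)) * arrowGSOCoord a x D d j i =
      c * x i / D n := by
  induction n, hn using Nat.le_induction with
  | base =>
    rw [sum_range_succ, sum_eq_zero, arrowGSOCoord_self]
    · have := (ha i).ne'
      have := (Dpos (i + 1)).ne'
      field_simp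
      ring
    · intro j hj
      rw [arrowGSOCoord_of_gt (by simpa using hj) hid, mul_zero]
  | succ n hn ih =>
    rw [sum_range_succ, ih, arrowGSOCoord_of_lt hn]
    have := (ha n).ne'
    have := (Dpos n).ne'
    have := (Dpos (n + 1)).ne'
    field_simp
    rw [Ds]
    ring

lemma sum_mul_arrowGSOCoord_last (ha : ∀ j, 0 < a j) (D0 : D 0 = 1)
    (Ds : ∀ j, D (j + 1) = D j + x j ^ 2) (Dpos : ∀ j, 0 < D j) (c : ℝ) (hn : n ≤ d) :
    ∑ j ∈ range n, c * x j / (a j * D (j + 1)) * arrowGSOCoord a x D d j d = c - c / D n := by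
  induction n with
  | zero => simp [D0]
  | succ n ih =>
    rw [sum_range_succ, ih (by omega), arrowGSOCoord_last hn]
    have := (ha n).ne'
    have := (Dpos n).ne'
    have := (Dpos (n + 1)).ne'
    field_simp
    rw [Ds]
    ring

end arrowGSOCoord

lemma sum_fin_Iio_eq_sum_range {d : ℕ} (k : Fin d) (f : ℕ → ℝ) :
    ∑ j ∈ Finset.Iio k, f j = ∑ j ∈ range k, f j := by
  rw [← Nat.Iio_eq_range, ← Fin.map_valEmbedding_Iio, sum_map]
  rfl

/-- Gram–Schmidt orthogonalization of the basis with diagonal entries `a j` and entries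
`a j * x j` in the last row. -/
lemma gso_eq_arrowGSOCoord {d : ℕ} {a x D : ℕ → ℝ} (ha : ∀ j, 0 < a j) (D0 : D 0 = 1)
    (Ds : ∀ j, D (j + 1) = D j + x j ^ 2) (Dpos : ∀ j, 0 < D j)
    {b gs : Fin d → EuclideanSpace ℝ (Fin (d + 1))}
    (hb : ∀ (j : Fin d) (i : Fin (d + 1)), b j i =
      if (i : ℕ) = (j : ℕ) then a j else if (i : ℕ) = d then a j * x j else 0)
    (hgs : ∀ k, gs k = b k - ∑ j ∈ Finset.Iio k, (⟪b k, gs j⟫ / ⟪gs j, gs j⟫) • gs j)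
    (k : Fin d) (i : Fin (d + 1)) : gs k i = arrowGSOCoord a x D d k i := by
  induction k using WellFoundedLT.induction generalizing i with
  | ind k ih =>
  have hcoef : ∀ j < k, ⟪b k, gs j⟫ / ⟪gs j, gs j⟫ =
      a k * x k * x j / (a j * D (j + 1)) := by
    intro j hj
    have hself : ⟪gs j, gs j⟫ = a j ^ 2 * D (j + 1) / D j := by
      rw [← sum_arrowGSOCoord_sq D0 Ds Dpos j.2, ← Fin.sum_univ_eq_sum_range
        (fun i => arrowGSOCoord a x D d j i * arrowGSOCoord a x D d j i)]
      simp only [PiLp.inner_apply, ih j hj]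
      rfl
    have hcross : ⟪b k, gs j⟫ = a k * x k * (a j * x j / D j) := by
      simp only [PiLp.inner_apply, ih j hj]
      rw [Fin.sum_univ_castSucc]
      simp only [hb, Fin.val_castSucc, Fin.val_last]
      rw [sum_eq_zero, zero_add, if_neg k.2.ne', if_pos trivial, arrowGSOCoord_last j.2]
      · exact mul_comm _ _
      · intro i _
        split_ifs with h h'
        · rw [h, arrowGSOCoord_of_gt hj k.2]
          simp
        · exact absurd h' i.2.ne
        · simp
    rw [hself, hcross]
    have := (ha j).ne'
    have := (Dpos j).ne'
    have := (Dpos (j + 1)).ne'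
    field_simp
  have hcoord : gs k i = b k i - ∑ j ∈ range k,
      a k * x k * x j / (a j * D (j + 1)) * arrowGSOCoord a x D d j i := by
    rw [hgs k, ← sum_fin_Iio_eq_sum_range k
      (fun j => a k * x k * x j / (a j * D (j + 1)) * arrowGSOCoord a x D d j i)]
    simp only [PiLp.sub_apply, WithLp.ofLp_sum, Finset.sum_apply, PiLp.smul_apply, smul_eq_mul]
    congr 1
    refine sum_congr rfl fun j hj => ?_
    rw [hcoef j (by simpa using hj), ih j (by simpa using hj)]
  rw [hcoord, hb]
  have hk := k.2
  rcases (Nat.lt_succ_iff.1 i.2).eq_or_lt with hid | hid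
  · rw [hid, if_neg hk.ne', if_pos rfl, sum_mul_arrowGSOCoord_last ha D0 Ds Dpos _ hk.le,
      arrowGSOCoord_last hk, sub_sub_cancel]
  rcases lt_or_ge (i : ℕ) k with hik | hik
  · rw [if_neg hik.ne, if_neg hid.ne, sum_mul_arrowGSOCoord_of_lt ha Ds Dpos _ hid hik,
      arrowGSOCoord_of_lt hik, zero_sub, neg_div]
  · rw [sum_eq_zero, sub_zero]
    · simp [arrowGSOCoord, hik.not_gt, hid.ne]
    · intro j hj
      rw [arrowGSOCoord_of_gt ((mem_range.1 hj).trans_le hik) hid, mul_zero]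

/-- Explicit Gram–Schmidt orthogonalization of the columns `b₁, …, b_d` of Schnorr's
`p`-norm Prime Number Lattice basis. -/
theorem schnorr_basis_gso_coords
    (d : ℕ) (hd : 1 ≤ d) (C p : ℝ) (hC : 0 < C) (hp : 1 ≤ p)
    (b : Fin d → EuclideanSpace ℝ (Fin (d + 1)))
    (hb : ∀ (j : Fin d) (i : Fin (d + 1)), b j i =
      if (i : ℕ) = (j : ℕ) then Real.log (Nat.nth Nat.Prime (j : ℕ)) ^ (1 / p)
      else if (i : ℕ) = d then C * Real.log (Nat.nth Nat.Prime (j : ℕ)) else 0)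
    (gs : Fin d → EuclideanSpace ℝ (Fin (d + 1)))
    (hgs : ∀ k, gs k = b k - ∑ j ∈ Finset.Iio k, (⟪b k, gs j⟫ / ⟪gs j, gs j⟫) • gs j)
    (D : ℕ → ℝ)
    (hD : ∀ j, D j = 1 + C ^ 2 * ∑ i ∈ Finset.range j,
      Real.log (Nat.nth Nat.Prime i) ^ (2 - 2 / p)) :
    ∀ (k : Fin d) (i : Fin (d + 1)),
      ((i : ℕ) < (k : ℕ) → gs k i =
        -(C ^ 2 * Real.log (Nat.nth Nat.Prime (k : ℕ)) *
          Real.log (Nat.nth Nat.Prime (i : ℕ)) ^ (1 - 1 / p)) / D k) ∧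
      ((i : ℕ) = (k : ℕ) → gs k i = Real.log (Nat.nth Nat.Prime (k : ℕ)) ^ (1 / p)) ∧
      ((k : ℕ) < (i : ℕ) ∧ (i : ℕ) < d → gs k i = 0) ∧
      ((i : ℕ) = d → gs k i = C * Real.log (Nat.nth Nat.Prime (k : ℕ)) / D k) := by
  have hlog : ∀ j, 0 < Real.log (Nat.nth Nat.Prime j) := fun j =>
    Real.log_pos (by exact_mod_cast (Nat.prime_nth_prime j).one_lt)
  set a : ℕ → ℝ := fun j => Real.log (Nat.nth Nat.Prime j) ^ (1 / p) with ha_def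
  set x : ℕ → ℝ := fun j => C * Real.log (Nat.nth Nat.Prime j) ^ (1 - 1 / p) with hx_def
  have ha : ∀ j, 0 < a j := fun j => Real.rpow_pos_of_pos (hlog j) _
  have hax : ∀ j, a j * x j = C * Real.log (Nat.nth Nat.Prime j) := by
    intro j
    rw [ha_def, hx_def]
    dsimp only
    rw [mul_left_comm, ← Real.rpow_add (hlog j), add_sub_cancel, Real.rpow_one]
  have hx2 : ∀ j, x j ^ 2 = C ^ 2 * Real.log (Nat.nth Nat.Prime j) ^ (2 - 2 / p) := by
    intro j
    rw [hx_def]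
    dsimp only
    rw [mul_pow, ← Real.rpow_mul_natCast (hlog j).le]
    congr 2
    push_cast
    ring
  have D0 : D 0 = 1 := by simp [hD]
  have Ds : ∀ j, D (j + 1) = D j + x j ^ 2 := by
    intro j
    rw [hD, hD, sum_range_succ, hx2]
    ring
  have Dpos : ∀ j, 0 < D j := by
    intro j
    rw [eq_one_add_sum_sq D0 Ds]
    positivity
  have key := gso_eq_arrowGSOCoord ha D0 Ds Dpos (by simpa only [hax] using hb) hgs
  intro k i
  rw [key k i]
  refine ⟨fun h => ?_, fun h => ?_, fun h => ?_, fun h => ?_⟩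
  · rw [arrowGSOCoord_of_lt h, hax, hx_def]
    ring
  · rw [h, arrowGSOCoord_self]
  · exact arrowGSOCoord_of_gt h.1 h.2
  · rw [h, arrowGSOCoord_last k.2, hax]
end

section
/- Let d ≥ 1, let p_1 < … < p_d be the first d prime numbers, let N ≥ 2 be an integer, let C > 0 and p ≥ 1 be reals, let b_1,…,b_d ∈ ℝ^{d+1} be the columns of Schnorr's p-norm Prime Number Lattice basis S_p, let t = C ln N·e_{d+1}, and set D_d = 1 + C² ∑_{i=1}^d (ln p_i)^{2−2/p}. Then the (d+1)-st vector t^⋆ of the Gram–Schmidt orthogonalization of the sequence b_1,…,b_d,t satisfies: the i-th coordinate of t^⋆ equals −C² (ln N)(ln p_i)^{1−1/p}/D_d for 1 ≤ i ≤ d, and the (d+1)-st coordinate equals C ln N / D_d. -/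
open Finset RealInnerProductSpace

/-- A family satisfying the Gram–Schmidt recursion is Mathlib's `gramSchmidt`. -/
lemma eq_gramSchmidt_of_recursion {E : Type*} [NormedAddCommGroup E] [InnerProductSpace ℝ E]
    {n : ℕ} {w gs : Fin n → E}
    (hgs : ∀ k, gs k = w k - ∑ j ∈ Finset.Iio k, (⟪w k, gs j⟫ / ⟪gs j, gs j⟫) • gs j) :
    gs = InnerProductSpace.gramSchmidt ℝ w := by
  funext k
  induction k using WellFoundedLT.induction with
  | ind k ih =>
    rw [hgs k, sub_eq_iff_eq_add]
    conv_lhs => rw [InnerProductSpace.gramSchmidt_def'' ℝ w k]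
    congr 1
    refine Finset.sum_congr rfl fun j hj => ?_
    rw [ih j (Finset.mem_Iio.mp hj), real_inner_comm, real_inner_self_eq_norm_sq]
    rfl

/-- A vector orthogonal to all earlier inputs has the same inner product with the `k`-th
Gram–Schmidt vector as with the `k`-th input. -/
lemma inner_gramSchmidt_eq_of_orthogonal {E : Type*} [NormedAddCommGroup E]
    [InnerProductSpace ℝ E] {n : ℕ} {w gs : Fin n → E}
    (hgs : ∀ k, gs k = w k - ∑ j ∈ Finset.Iio k, (⟪w k, gs j⟫ / ⟪gs j, gs j⟫) • gs j)
    (u : E) (k : Fin n) (hu : ∀ j < k, ⟪u, w j⟫ = 0) : ⟪u, gs k⟫ = ⟪u, w k⟫ := by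
  induction k using WellFoundedLT.induction with
  | ind k ih =>
    rw [hgs k, inner_sub_right, inner_sum, Finset.sum_eq_zero, sub_zero]
    intro j hj
    have hjk := Finset.mem_Iio.mp hj
    rw [inner_smul_right, ih j hjk fun i hi => hu i (hi.trans hjk), hu j hjk, mul_zero]

/-- Explicit coordinates of `t⋆`, the last vector of the Gram–Schmidt orthogonalization of
the sequence `b₁, …, b_d, t`, where the `b_i` are the columns of Schnorr's `p`-norm Prime
Number Lattice basis and `t = C ln N · e_{d+1}` is the target vector. -/
theorem schnorr_target_gso_coords
    (d : ℕ) (hd : 1 ≤ d) (N : ℕ) (hN : 2 ≤ N) (C p : ℝ) (hC : 0 < C) (hp : 1 ≤ p)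
    (w : Fin (d + 1) → EuclideanSpace ℝ (Fin (d + 1)))
    (hw : ∀ (j i : Fin (d + 1)), w j i =
      if (j : ℕ) < d then
        (if (i : ℕ) = (j : ℕ) then Real.log (Nat.nth Nat.Prime (j : ℕ)) ^ (1 / p)
         else if (i : ℕ) = d then C * Real.log (Nat.nth Nat.Prime (j : ℕ)) else 0)
      else (if (i : ℕ) = d then C * Real.log N else 0))
    (gs : Fin (d + 1) → EuclideanSpace ℝ (Fin (d + 1)))
    (hgs : ∀ k, gs k = w k - ∑ j ∈ Finset.Iio k, (⟪w k, gs j⟫ / ⟪gs j, gs j⟫) • gs j)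
    (D : ℕ → ℝ)
    (hD : ∀ j, D j = 1 + C ^ 2 * ∑ i ∈ Finset.range j,
      Real.log (Nat.nth Nat.Prime i) ^ (2 - 2 / p)) :
    ∀ i : Fin (d + 1),
      ((i : ℕ) < d → gs (Fin.last d) i =
        -(C ^ 2 * Real.log N * Real.log (Nat.nth Nat.Prime (i : ℕ)) ^ (1 - 1 / p)) / D d) ∧
      ((i : ℕ) = d → gs (Fin.last d) i = C * Real.log N / D d) := by
  set a : ℕ → ℝ := fun i => Real.log (Nat.nth Nat.Prime i) with ha
  have hapos : ∀ i, 0 < a i := fun i =>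
    Real.log_pos (by exact_mod_cast (Nat.prime_nth_prime i).one_lt)
  have hmul : ∀ i, a i ^ (1 / p) * a i ^ (1 - 1 / p) = a i := fun i => by
    rw [← Real.rpow_add (hapos i)]
    simp
  have hsq : ∀ i, a i ^ (1 - 1 / p) * a i ^ (1 - 1 / p) = a i ^ (2 - 2 / p) := fun i => by
    rw [← Real.rpow_add (hapos i)]
    congr 1
    ring
  have hwc : ∀ (v : EuclideanSpace ℝ (Fin (d + 1))) (j : Fin d), ⟪v, w j.castSucc⟫ =
      a j ^ (1 / p) * v j.castSucc + C * a j * v (Fin.last d) := fun v j => by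
    rw [PiLp.inner_apply, Fin.sum_univ_castSucc, Finset.sum_eq_single j]
    · simp [hw, ha, j.isLt.ne']
    · intro i _ hij
      simp [hw, Fin.val_ne_of_ne hij, i.isLt.ne]
    · simp
  have hwl : ∀ v : EuclideanSpace ℝ (Fin (d + 1)), ⟪v, w (Fin.last d)⟫ =
      C * Real.log N * v (Fin.last d) := fun v => by
    rw [PiLp.inner_apply, Fin.sum_univ_castSucc, Finset.sum_eq_zero]
    · simp [hw]
    · intro i _
      simp [hw, i.isLt.ne]
  set g := gs (Fin.last d) with hg
  have hcoord : ∀ j : Fin d,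
      g j.castSucc = -(C * a j ^ (1 - 1 / p)) * g (Fin.last d) := fun j => by
    have h : ⟪g, w j.castSucc⟫ = 0 := by
      rw [hg, eq_gramSchmidt_of_recursion hgs]
      exact InnerProductSpace.gramSchmidt_inv_triangular ℝ w (Fin.castSucc_lt_last j)
    rw [hwc] at h
    have hne : a j ^ (1 / p) ≠ 0 := (Real.rpow_pos_of_pos (hapos j) _).ne'
    apply mul_left_cancel₀ hne
    linear_combination h + C * g (Fin.last d) * hmul j
  let u : EuclideanSpace ℝ (Fin (d + 1)) :=
    WithLp.toLp 2 (Fin.snoc (α := fun _ => ℝ) (fun j : Fin d => -(C * a j ^ (1 - 1 / p))) 1)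
  have huc : ∀ j : Fin d, u j.castSucc = -(C * a j ^ (1 - 1 / p)) := fun j => by simp [u]
  have hul : u (Fin.last d) = 1 := by simp [u]
  have horth : ∀ j < Fin.last d, ⟪u, w j⟫ = 0 := fun j hj => by
    obtain ⟨j, rfl⟩ := Fin.exists_castSucc_eq.mpr hj.ne
    rw [hwc, huc, hul]
    linear_combination -C * hmul j
  have hinner : ⟪u, g⟫ = g (Fin.last d) * D d := by
    rw [PiLp.inner_apply, Fin.sum_univ_castSucc, hD, Finset.sum_range, mul_add, mul_one,
      add_comm, Finset.mul_sum, Finset.mul_sum]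
    congr 1
    · simp [hul]
    · refine Finset.sum_congr rfl fun j _ => ?_
      rw [hcoord, huc]
      simp only [RCLike.inner_apply, conj_trivial]
      linear_combination C ^ 2 * g (Fin.last d) * hsq j
  have hDpos : 0 < D d := by
    rw [hD]
    have := Finset.sum_nonneg fun i (_ : i ∈ Finset.range d) =>
      (Real.rpow_pos_of_pos (hapos i) (2 - 2 / p)).le
    positivity
  have hlast : g (Fin.last d) = C * Real.log N / D d := by
    rw [eq_div_iff hDpos.ne', ← hinner, inner_gramSchmidt_eq_of_orthogonal hgs u _ horth, hwl,
      hul, mul_one]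
  intro i
  refine ⟨fun hi => ?_, fun hi => ?_⟩
  · have h := hcoord ⟨i, hi⟩
    rw [hlast] at h
    refine h.trans ?_
    ring
  · rw [show i = Fin.last d from Fin.ext hi, hlast]
end

section
/- Let d ≥ 1, let p_1 < … < p_d be the first d prime numbers, let N ≥ 2 be an integer, let C > 0 and p ≥ 1 be reals, let b_1,…,b_d be the columns of Schnorr's p-norm Prime Number Lattice basis S_p, let t = C ln N·e_{d+1}, and set D_j = 1 + C² ∑_{i=1}^j (ln p_i)^{2−2/p} for 0 ≤ j ≤ d. Let b_1^⋆,…,b_d^⋆,t^⋆ be the Gram–Schmidt orthogonalization of b_1,…,b_d,t. Then for all 1 ≤ k ≤ d, the squared Euclidean norm ‖b_k^⋆‖² equals (ln p_k)^{2/p}·D_k/D_{k−1}, and ‖t^⋆‖² = (C ln N)²/D_d. -/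
open Finset RealInnerProductSpace

section Arrow

variable {E : Type*} [NormedAddCommGroup E] [InnerProductSpace ℝ E]

/-- The vector `e_d - ∑_{i < k} r_i e_i`, orthogonal to `e_i + r_i e_d` for every `i < k`. -/
def arrowNormal (e : ℕ → E) (d : ℕ) (r : ℕ → ℝ) (k : ℕ) : E :=
  e d - ∑ i ∈ range k, r i • e i

variable {e : ℕ → E} {d : ℕ} {r : ℕ → ℝ}

lemma arrowNormal_succ (k : ℕ) :
    arrowNormal e d r (k + 1) = arrowNormal e d r k - r k • e k := by
  simp only [arrowNormal, sum_range_succ]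
  abel

lemma inner_arrowNormal_of_le (he : ∀ i ≤ d, ∀ j ≤ d, ⟪e i, e j⟫ = if i = j then 1 else 0)
    {j k : ℕ} (hk : k < d) (hj : j ≤ k) : ⟪e k, arrowNormal e d r j⟫ = 0 := by
  rw [arrowNormal, inner_sub_right, inner_sum, he k hk.le d le_rfl, if_neg hk.ne,
    sum_eq_zero, sub_zero]
  intro i hi
  have := mem_range.1 hi
  rw [inner_smul_right, he k hk.le i (by omega), if_neg (by omega), mul_zero]

lemma inner_last_arrowNormal (he : ∀ i ≤ d, ∀ j ≤ d, ⟪e i, e j⟫ = if i = j then 1 else 0)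
    {k : ℕ} (hk : k ≤ d) : ⟪e d, arrowNormal e d r k⟫ = 1 := by
  rw [arrowNormal, inner_sub_right, inner_sum, he d le_rfl d le_rfl, if_pos rfl,
    sum_eq_zero, sub_zero]
  intro i hi
  have := mem_range.1 hi
  rw [inner_smul_right, he d le_rfl i (by omega), if_neg (by omega), mul_zero]

lemma inner_arrowNormal_self (he : ∀ i ≤ d, ∀ j ≤ d, ⟪e i, e j⟫ = if i = j then 1 else 0)
    {k : ℕ} (hk : k ≤ d) :
    ⟪arrowNormal e d r k, arrowNormal e d r k⟫ = 1 + ∑ i ∈ range k, r i ^ 2 := by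
  induction k with
  | zero => simpa [arrowNormal] using he d le_rfl d le_rfl
  | succ k ih =>
    have h := inner_arrowNormal_of_le (r := r) he (show k < d by omega) le_rfl
    rw [arrowNormal_succ, inner_sub_left, inner_sub_right, inner_sub_right, ih (by omega),
      inner_smul_left, inner_smul_right, inner_smul_right, inner_smul_left,
      real_inner_comm, h, he k (by omega) k (by omega), sum_range_succ]
    simp
    ring

variable {a c : ℕ → ℝ} {D : ℕ → ℝ} {g : ℕ → E}

lemma inner_self_arrow (he : ∀ i ≤ d, ∀ j ≤ d, ⟪e i, e j⟫ = if i = j then 1 else 0)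
    (had : a d = 0) (hD : ∀ k, D k = 1 + ∑ i ∈ range k, r i ^ 2) {k : ℕ} (hk : k ≤ d) :
    ⟪a k • e k + (c k / D k) • arrowNormal e d r k,
      a k • e k + (c k / D k) • arrowNormal e d r k⟫ = a k ^ 2 + c k ^ 2 / D k := by
  have hDk : 0 < D k := by rw [hD]; positivity
  have hn := inner_arrowNormal_self (r := r) he hk
  rw [← hD] at hn
  rcases hk.lt_or_eq with h | rfl
  · have h0 := inner_arrowNormal_of_le (r := r) he h le_rfl
    have h1 := he k hk k hk
    rw [if_pos rfl] at h1
    simp only [inner_add_left, inner_add_right, real_inner_smul_left, real_inner_smul_right,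
      real_inner_comm (e k) (arrowNormal e d r k), h0, h1, hn]
    field_simp
    ring
  · simp only [had, zero_smul, zero_add, real_inner_smul_left, real_inner_smul_right, hn]
    field_simp
    ring

/-- Gram–Schmidt vectors of the sequence `a_k e_k + c_k e_d`. -/
lemma gramSchmidt_arrow (he : ∀ i ≤ d, ∀ j ≤ d, ⟪e i, e j⟫ = if i = j then 1 else 0)
    (had : a d = 0) (ha : ∀ i < d, a i ≠ 0) (hr : ∀ i < d, c i = r i * a i)
    (hD : ∀ k, D k = 1 + ∑ i ∈ range k, r i ^ 2)
    (hg : ∀ k ≤ d, g k = (a k • e k + c k • e d) -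
      ∑ j ∈ range k, (⟪a k • e k + c k • e d, g j⟫ / ⟪g j, g j⟫) • g j) :
    ∀ k ≤ d, g k = a k • e k + (c k / D k) • arrowNormal e d r k := by
  intro k
  induction k using Nat.strong_induction_on with
  | _ k ih =>
  intro hk
  have hpos : ∀ j, 0 < D j := fun j => by rw [hD]; positivity
  have term : ∀ j ∈ range k, (⟪a k • e k + c k • e d, g j⟫ / ⟪g j, g j⟫) • g j =
      c k • ((1 / D j) • arrowNormal e d r j - (1 / D (j + 1)) • arrowNormal e d r (j + 1)) := by
    intro j hj
    have hjk := mem_range.1 hj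
    have hjd : j < d := by omega
    have hl := inner_last_arrowNormal (r := r) he hjd.le
    have hkj : a k * ⟪e k, a j • e j + (c j / D j) • arrowNormal e d r j⟫ = 0 := by
      rcases hk.lt_or_eq with h | rfl
      · rw [inner_add_right, real_inner_smul_right, real_inner_smul_right,
          inner_arrowNormal_of_le he h hjk.le, he k hk j hjd.le, if_neg hjk.ne']
        simp
      · rw [had, zero_mul]
    have hnum : ⟪a k • e k + c k • e d, g j⟫ = c k * (c j / D j) := by
      rw [ih j hjk hjd.le, inner_add_left, real_inner_smul_left, real_inner_smul_left, hkj,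
        inner_add_right, real_inner_smul_right, real_inner_smul_right, hl,
        he d le_rfl j hjd.le, if_neg hjd.ne']
      ring
    have hden : ⟪g j, g j⟫ = a j ^ 2 * D (j + 1) / D j := by
      have hDs : D (j + 1) = D j + r j ^ 2 := by rw [hD, hD, sum_range_succ]; ring
      rw [ih j hjk hjd.le, inner_self_arrow he had hD hjd.le, hr j hjd, hDs]
      have := (hpos j).ne'
      field_simp
    have hDs : D (j + 1) = D j + r j ^ 2 := by rw [hD, hD, sum_range_succ]; ring
    have h1 := (hpos j).ne'
    have h2 := (hpos (j + 1)).ne'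
    have h3 := ha j hjd
    rw [hnum, hden, ih j hjk hjd.le, arrowNormal_succ, hr j hjd]
    match_scalars
    · field_simp
    · field_simp
      rw [hDs]
      ring
  rw [hg k hk, sum_congr rfl term, ← smul_sum,
    sum_range_sub' (fun j => (1 / D j) • arrowNormal e d r j)]
  have h0 : D 0 = 1 := by simp [hD]
  have hn0 : arrowNormal e d r 0 = e d := by simp [arrowNormal]
  rw [h0, hn0]
  module

end Arrow

/-- Squared Euclidean norms of the Gram–Schmidt vectors of the sequence `b₁, …, b_d, t`:
`‖b_k⋆‖² = (ln p_k)^{2/p} · D_k / D_{k−1}` and `‖t⋆‖² = (C ln N)² / D_d`. -/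
theorem schnorr_gso_norms
    (d : ℕ) (hd : 1 ≤ d) (N : ℕ) (hN : 2 ≤ N) (C p : ℝ) (hC : 0 < C) (hp : 1 ≤ p)
    (w : Fin (d + 1) → EuclideanSpace ℝ (Fin (d + 1)))
    (hw : ∀ (j i : Fin (d + 1)), w j i =
      if (j : ℕ) < d then
        (if (i : ℕ) = (j : ℕ) then Real.log (Nat.nth Nat.Prime (j : ℕ)) ^ (1 / p)
         else if (i : ℕ) = d then C * Real.log (Nat.nth Nat.Prime (j : ℕ)) else 0)
      else (if (i : ℕ) = d then C * Real.log N else 0))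
    (gs : Fin (d + 1) → EuclideanSpace ℝ (Fin (d + 1)))
    (hgs : ∀ k, gs k = w k - ∑ j ∈ Finset.Iio k, (⟪w k, gs j⟫ / ⟪gs j, gs j⟫) • gs j)
    (D : ℕ → ℝ)
    (hD : ∀ j, D j = 1 + C ^ 2 * ∑ i ∈ Finset.range j,
      Real.log (Nat.nth Nat.Prime i) ^ (2 - 2 / p)) :
    ∀ k : Fin (d + 1),
      ((k : ℕ) < d → ‖gs k‖ ^ 2 =
        Real.log (Nat.nth Nat.Prime (k : ℕ)) ^ (2 / p) * D ((k : ℕ) + 1) / D k) ∧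
      ((k : ℕ) = d → ‖gs k‖ ^ 2 = (C * Real.log N) ^ 2 / D d) := by
  have hlog : ∀ i, 0 < Real.log (Nat.nth Nat.Prime i) := fun i =>
    Real.log_pos (by exact_mod_cast (Nat.prime_nth_prime i).one_lt)
  set l : ℕ → ℝ := fun i => Real.log (Nat.nth Nat.Prime i)
  let e : ℕ → EuclideanSpace ℝ (Fin (d + 1)) := fun n =>
    EuclideanSpace.single (Fin.ofNat (d + 1) n) 1
  let a : ℕ → ℝ := fun n => if n < d then l n ^ (1 / p) else 0
  let c : ℕ → ℝ := fun n => if n < d then C * l n else C * Real.log N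
  let r : ℕ → ℝ := fun n => C * l n ^ (1 - 1 / p)
  have he : ∀ i ≤ d, ∀ j ≤ d, ⟪e i, e j⟫ = if i = j then (1 : ℝ) else 0 := by
    intro i hi j hj
    have : Fin.ofNat (d + 1) i = Fin.ofNat (d + 1) j ↔ i = j := by
      simp [Fin.ext_iff, Nat.mod_eq_of_lt (Nat.lt_succ_of_le hi),
        Nat.mod_eq_of_lt (Nat.lt_succ_of_le hj)]
    simp only [e, EuclideanSpace.inner_single_left, PiLp.single_apply, this, map_one, one_mul]
  have had : a d = 0 := by simp [a]
  have ha : ∀ i < d, a i ≠ 0 := fun i hi => by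
    simpa [a, hi] using (Real.rpow_pos_of_pos (hlog i) _).ne'
  have hr : ∀ i < d, c i = r i * a i := fun i hi => by
    simp only [a, c, r, if_pos hi]
    rw [mul_assoc, ← Real.rpow_add (hlog i), sub_add_cancel, Real.rpow_one]
  have hD' : ∀ k, D k = 1 + ∑ i ∈ range k, r i ^ 2 := fun k => by
    rw [hD, mul_sum]
    congr 1
    refine sum_congr rfl fun i _ => ?_
    rw [mul_pow, ← Real.rpow_mul_natCast (hlog i).le]
    congr 2
    push_cast
    ring
  have hwk : ∀ k : Fin (d + 1), w k = a k • e k + c k • e d := by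
    intro k
    ext i
    have hi : i = Fin.ofNat (d + 1) d ↔ (i : ℕ) = d := by simp [Fin.ext_iff]
    have hik : i = Fin.ofNat (d + 1) k ↔ (i : ℕ) = k := by simp [Fin.ext_iff]
    rw [hw]
    simp only [e, a, c, PiLp.add_apply, PiLp.smul_apply, PiLp.single_apply, hi, hik,
      smul_eq_mul, l]
    split_ifs <;> first | omega | simp
  have hg : ∀ k ≤ d, gs (Fin.ofNat (d + 1) k) = (a k • e k + c k • e d) -
      ∑ j ∈ range k, (⟪a k • e k + c k • e d, gs (Fin.ofNat (d + 1) j)⟫ /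
        ⟪gs (Fin.ofNat (d + 1) j), gs (Fin.ofNat (d + 1) j)⟫) • gs (Fin.ofNat (d + 1) j) := by
    intro k hk
    have hval : ((Fin.ofNat (d + 1) k : Fin (d + 1)) : ℕ) = k :=
      Nat.mod_eq_of_lt (Nat.lt_succ_of_le hk)
    have hrange : range k = (Iio (Fin.ofNat (d + 1) k)).map Fin.valEmbedding := by
      rw [Fin.map_valEmbedding_Iio, hval, Nat.Iio_eq_range]
    have hw' := hwk (Fin.ofNat (d + 1) k)
    rw [hval] at hw'
    rw [hgs, hrange, sum_map, hw']
    simp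
  have key := gramSchmidt_arrow he had ha hr hD' hg
  intro k
  have hk : (k : ℕ) ≤ d := Nat.lt_succ_iff.1 k.isLt
  have hgk : ‖gs k‖ ^ 2 = a k ^ 2 + c k ^ 2 / D k := by
    have h := key k hk
    rw [show Fin.ofNat (d + 1) (k : ℕ) = k from Fin.ext (Nat.mod_eq_of_lt k.isLt)] at h
    rw [← real_inner_self_eq_norm_sq, h, inner_self_arrow he had hD' hk]
  have hpos : 0 < D k := by rw [hD']; positivity
  refine ⟨fun h => ?_, fun h => ?_⟩
  · have hsq : l k ^ (2 / p) = a k ^ 2 := by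
      simp only [a, if_pos h]
      rw [← Real.rpow_mul_natCast (hlog k).le]
      congr 1
      push_cast
      ring
    have hDs : D (k + 1) = D k + r k ^ 2 := by rw [hD', hD', sum_range_succ]; ring
    rw [hgk, hr k h, hsq, hDs]
    field_simp
  · rw [hgk, h, had]
    simp [c]
end

section
/- Let d ≥ 1, let p_1 < … < p_d be the first d prime numbers, let N ≥ 2 be an integer, let C > 1 be real, and let A_1 be Adleman's 1-norm Prime Number Lattice basis matrix. Let z ∈ ℤ^{d+1} have strictly negative last coordinate, set γ = |z_{d+1}| ≥ 1, u = ∏_{1≤i≤d, z_i>0} p_i^{z_i} and k = ∏_{1≤i≤d, z_i<0} p_i^{−z_i}. If ‖A_1 z‖_1 ≤ ε for a real ε, then |u − k N^γ| ≤ (N^{γ/2}/C)·exp(ε/2). -/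
open Finset Matrix

theorem mul_sinh_le_sinh_mul {C x : ℝ} (hC : 1 ≤ C) (hx : 0 ≤ x) :
    C * Real.sinh x ≤ Real.sinh (C * x) := by
  have hderiv : ∀ y : ℝ, HasDerivAt (fun t => Real.sinh (C * t) - C * Real.sinh t)
      (Real.cosh (C * y) * (C * 1) - C * Real.cosh y) y := fun y =>
    (((hasDerivAt_id y).const_mul C).sinh).sub ((Real.hasDerivAt_sinh y).const_mul C)
  have hmono : MonotoneOn (fun t => Real.sinh (C * t) - C * Real.sinh t) (Set.Ici 0) := by
    refine monotoneOn_of_deriv_nonneg (convex_Ici 0)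
      (fun y _ => (hderiv y).continuousAt.continuousWithinAt)
      (fun y _ => (hderiv y).differentiableAt.differentiableWithinAt) fun y hy => ?_
    rw [interior_Ici, Set.mem_Ioi] at hy
    rw [(hderiv y).deriv]
    have hcosh : Real.cosh y ≤ Real.cosh (C * y) := by
      rw [Real.cosh_le_cosh, abs_of_pos hy, abs_of_pos (by positivity)]
      nlinarith
    nlinarith
  have := hmono Set.self_mem_Ici hx hx
  simp at this
  linarith

theorem abs_exp_sub_exp_le {C : ℝ} (hC : 1 ≤ C) (a b : ℝ) :
    |Real.exp a - Real.exp b| ≤ Real.exp ((a + b + C * |a - b|) / 2) / C := by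
  wlog hab : b ≤ a generalizing a b
  · rw [abs_sub_comm, abs_sub_comm a, add_comm a]
    exact this b a (le_of_not_ge hab)
  have hC0 : 0 < C := by linarith
  rw [abs_of_nonneg (sub_nonneg.2 (Real.exp_le_exp.2 hab)), abs_of_nonneg (sub_nonneg.2 hab),
    le_div_iff₀ hC0]
  have hs := mul_sinh_le_sinh_mul hC (show 0 ≤ (a - b) / 2 by linarith)
  rw [Real.sinh_eq, Real.sinh_eq] at hs
  have hpos := Real.exp_pos (-(C * ((a - b) / 2)))
  have ha : Real.exp a = Real.exp ((a + b) / 2) * Real.exp ((a - b) / 2) := by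
    rw [← Real.exp_add]; ring_nf
  have hb : Real.exp b = Real.exp ((a + b) / 2) * Real.exp (-((a - b) / 2)) := by
    rw [← Real.exp_add]; ring_nf
  have hc : Real.exp ((a + b + C * (a - b)) / 2) =
      Real.exp ((a + b) / 2) * Real.exp (C * ((a - b) / 2)) := by
    rw [← Real.exp_add]; ring_nf
  rw [ha, hb, hc]
  calc _ = Real.exp ((a + b) / 2) *
        (C * (Real.exp ((a - b) / 2) - Real.exp (-((a - b) / 2)))) := by ring
    _ ≤ _ := by gcongr; linarith

theorem log_prod_ite_pow {ι : Type*} (s : Finset ι) (P : ι → Prop) [DecidablePred P]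
    (p e : ι → ℕ) (hp : ∀ i ∈ s, p i ≠ 0) :
    Real.log ((∏ i ∈ s, if P i then p i ^ e i else 1 : ℕ) : ℝ) =
      ∑ i ∈ s, if P i then (e i : ℝ) * Real.log (p i) else 0 := by
  push_cast
  rw [Real.log_prod]
  · refine Finset.sum_congr rfl fun i _ => ?_
    split_ifs <;> simp
  · intro i hi
    have := hp i hi
    split_ifs <;> simp [this]

/-- Lemma `svp-suff`: if `‖A₁ z‖₁ ≤ ε` for a vector `z` with strictly negative last
coordinate, then `|u − k N^γ| ≤ (N^{γ/2}/C) · exp(ε/2)`. -/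
theorem adleman_svp_suff
    (d : ℕ) (hd : 1 ≤ d) (N : ℕ) (hN : 2 ≤ N) (C : ℝ) (hC : 1 < C)
    (A : Matrix (Fin (d + 1)) (Fin (d + 1)) ℝ)
    (hA : ∀ i j, A i j =
      if (i : ℕ) = d then
        (if (j : ℕ) = d then C * Real.log N else C * Real.log (Nat.nth Nat.Prime (j : ℕ)))
      else if (i : ℕ) = (j : ℕ) then Real.log (Nat.nth Nat.Prime (j : ℕ)) else 0)
    (z : Fin (d + 1) → ℤ) (hz : z (Fin.last d) < 0)
    (γ : ℕ) (hγ : γ = (z (Fin.last d)).natAbs)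
    (u : ℕ) (hu : u = ∏ i : Fin d,
      if 0 < z i.castSucc then Nat.nth Nat.Prime (i : ℕ) ^ (z i.castSucc).toNat else 1)
    (k : ℕ) (hk : k = ∏ i : Fin d,
      if z i.castSucc < 0 then Nat.nth Nat.Prime (i : ℕ) ^ (-z i.castSucc).toNat else 1)
    (ε : ℝ)
    (h : ∑ i, |A.mulVec (fun j => (z j : ℝ)) i| ≤ ε) :
    |(u : ℝ) - k * (N : ℝ) ^ γ| ≤ (N : ℝ) ^ ((γ : ℝ) / 2) / C * Real.exp (ε / 2) := by
  set p : Fin d → ℕ := fun i => Nat.nth Nat.Prime (i : ℕ) with hp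
  have hprime : ∀ i, (p i).Prime := fun i => Nat.prime_nth_prime i
  have hlog : ∀ i, 0 ≤ Real.log (p i) := fun i => Real.log_natCast_nonneg _
  have hlogu := congrArg (fun n : ℕ => Real.log n) hu
  have hlogk := congrArg (fun n : ℕ => Real.log n) hk
  rw [log_prod_ite_pow _ _ p _ fun i _ => (hprime i).ne_zero] at hlogu hlogk
  have hu0 : (0 : ℝ) < u := by
    rw [hu, Nat.cast_pos]
    refine Finset.prod_pos fun i _ => ?_
    split_ifs
    exacts [pow_pos (hprime i).pos _, one_pos]
  have hk0 : (0 : ℝ) < k := by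
    rw [hk, Nat.cast_pos]
    refine Finset.prod_pos fun i _ => ?_
    split_ifs
    exacts [pow_pos (hprime i).pos _, one_pos]
  have hN0 : (0 : ℝ) < N := by positivity
  have hγz : (z (Fin.last d) : ℝ) = -γ := by
    have : z (Fin.last d) = -(γ : ℤ) := by omega
    rw [this]; simp
  have hcast : ∀ n : ℤ, n ≤ 0 → (((-n).toNat : ℕ) : ℝ) = -n := fun n hn => by
    exact_mod_cast congrArg (Int.cast : ℤ → ℝ) (Int.toNat_of_nonneg (neg_nonneg.2 hn))
  have hcast' : ∀ n : ℤ, 0 ≤ n → ((n.toNat : ℕ) : ℝ) = n := fun n hn => by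
    exact_mod_cast congrArg (Int.cast : ℤ → ℝ) (Int.toNat_of_nonneg hn)
  have hcoord : ∀ i : Fin d, A.mulVec (fun j => (z j : ℝ)) i.castSucc =
      Real.log (p i) * z i.castSucc := by
    intro i
    rw [Matrix.mulVec, dotProduct, Finset.sum_eq_single i.castSucc]
    · simp [hA, i.isLt.ne, hp]
    · intro j _ hj
      have hij : (i : ℕ) ≠ j := fun hval => hj (Fin.ext hval.symm)
      simp [hA, i.isLt.ne, hij]
    · simp
  have hlast : A.mulVec (fun j => (z j : ℝ)) (Fin.last d) =
      C * (Real.log u - (Real.log k + γ * Real.log N)) := by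
    rw [Matrix.mulVec, dotProduct, Fin.sum_univ_castSucc, hlogu, hlogk, hγz]
    simp only [hA, Fin.val_last, Fin.val_castSucc, if_true]
    rw [← sub_sub, ← Finset.sum_sub_distrib, mul_sub, Finset.mul_sum, sub_eq_add_neg]
    congr 1
    · refine Finset.sum_congr rfl fun i _ => ?_
      rw [if_neg i.isLt.ne]
      rcases lt_trichotomy (z i.castSucc) 0 with hi | hi | hi
      · rw [if_neg hi.not_gt, if_pos hi, hcast _ hi.le]
        ring
      · simp [hi]
      · rw [if_pos hi, if_neg hi.not_gt, hcast' _ hi.le]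
        ring
    · ring
  have habs : ∑ i : Fin d, |Real.log (p i) * z i.castSucc| = Real.log u + Real.log k := by
    rw [hlogu, hlogk, ← Finset.sum_add_distrib]
    refine Finset.sum_congr rfl fun i _ => ?_
    rw [abs_mul, abs_of_nonneg (hlog i)]
    rcases lt_trichotomy (z i.castSucc) 0 with hi | hi | hi
    · rw [if_neg hi.not_gt, if_pos hi, hcast _ hi.le, abs_of_neg (Int.cast_lt_zero.2 hi)]
      ring
    · simp [hi]
    · rw [if_pos hi, if_neg hi.not_gt, hcast' _ hi.le, abs_of_pos (Int.cast_pos.2 hi)]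
      ring
  rw [Fin.sum_univ_castSucc, hlast, Finset.sum_congr rfl fun i _ => by rw [hcoord i], habs,
    abs_mul, abs_of_pos (by linarith : 0 < C)] at h
  have key := abs_exp_sub_exp_le hC.le (Real.log u) (Real.log k + γ * Real.log N)
  have hpow : Real.exp (γ * Real.log N) = (N : ℝ) ^ γ := by
    rw [Real.exp_nat_mul, Real.exp_log hN0]
  rw [Real.exp_add, hpow, Real.exp_log hu0, Real.exp_log hk0] at key
  refine key.trans ?_
  rw [Real.rpow_def_of_pos hN0, div_mul_eq_mul_div, ← Real.exp_add]
  gcongr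
  linarith
end

section
/- Let d ≥ 1, let x_1,…,x_d be nonzero real numbers and y_1,…,y_{d+1} real numbers with y_{d+1} ≠ 0, and let v_1,…,v_{d+1} ∈ ℝ^{d+1} be defined by v_i = x_i·e_i + y_i·e_{d+1} for 1 ≤ i ≤ d and v_{d+1} = y_{d+1}·e_{d+1}. Set K_0 = 1 and K_j = 1 + ∑_{i=1}^j (y_i/x_i)² for 1 ≤ j ≤ d. Then the Gram–Schmidt orthogonalization v_1^⋆,…,v_{d+1}^⋆ of v_1,…,v_{d+1} satisfies: for 1 ≤ k ≤ d, the i-th coordinate of v_k^⋆ equals −(y_k/K_{k−1})·(y_i/x_i) for i < k, equals x_k for i = k, equals 0 for k < i < d+1, and equals y_k/K_{k−1} for i = d+1; and the coordinates of v_{d+1}^⋆ are −(y_{d+1}/K_d)·(y_i/x_i) for 1 ≤ i ≤ d and y_{d+1}/K_d for i = d+1. -/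
open Finset RealInnerProductSpace

/-- The partial sums `1 + ∑_{i < j} (y i / x i)²`. -/
noncomputable def gsoK (x y : ℕ → ℝ) (j : ℕ) : ℝ :=
  1 + ∑ i ∈ Finset.range j, (y i / x i) ^ 2

/-- The claimed `i`-th coordinate of the `k`-th Gram–Schmidt vector. -/
noncomputable def gsoCoord (d : ℕ) (x y : ℕ → ℝ) (k i : ℕ) : ℝ :=
  if i < k then -(y k / gsoK x y k) * (y i / x i)
  else if i = d then y k / gsoK x y k
  else if i = k then x k else 0

lemma gsoK_pos (x y : ℕ → ℝ) (j : ℕ) : 0 < gsoK x y j := by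
  unfold gsoK
  positivity

lemma gsoK_succ (x y : ℕ → ℝ) (j : ℕ) : gsoK x y (j + 1) = gsoK x y j + (y j / x j) ^ 2 := by
  simp only [gsoK, Finset.sum_range_succ, add_assoc]

lemma sum_range_gsoCoord_sq_self (d : ℕ) (x y : ℕ → ℝ) (j : ℕ) :
    ∑ i ∈ Finset.range j, gsoCoord d x y j i * gsoCoord d x y j i =
      (y j / gsoK x y j) ^ 2 * (gsoK x y j - 1) := by
  rw [show gsoK x y j - 1 = ∑ i ∈ Finset.range j, (y i / x i) ^ 2 by simp [gsoK],
    Finset.mul_sum]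
  refine Finset.sum_congr rfl fun i hi => ?_
  rw [gsoCoord, if_pos (Finset.mem_range.1 hi)]
  ring

lemma sum_gsoCoord_sq {d : ℕ} (x y : ℕ → ℝ) {j : ℕ} (hj : j < d) (hx : x j ≠ 0) :
    ∑ i ∈ Finset.range (d + 1), gsoCoord d x y j i * gsoCoord d x y j i =
      x j ^ 2 * gsoK x y (j + 1) / gsoK x y j := by
  have partial_sum : ∀ n, j + 1 ≤ n → n ≤ d →
      ∑ i ∈ Finset.range n, gsoCoord d x y j i * gsoCoord d x y j i =
        (y j / gsoK x y j) ^ 2 * (gsoK x y j - 1) + x j ^ 2 := by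
    intro n hn
    induction n, hn using Nat.le_induction with
    | base =>
      intro _
      rw [Finset.sum_range_succ, sum_range_gsoCoord_sq_self d x y j, gsoCoord,
        if_neg (lt_irrefl j), if_neg hj.ne, if_pos rfl, sq (x j)]
    | succ n hn ih =>
      intro hnd
      rw [Finset.sum_range_succ, ih (by omega), gsoCoord, if_neg (by omega), if_neg (by omega),
        if_neg (by omega), mul_zero, add_zero]
  rw [Finset.sum_range_succ, partial_sum d hj le_rfl, gsoCoord, if_neg (by omega), if_pos rfl,
    gsoK_succ]
  have := (gsoK_pos x y j).ne'
  field_simp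
  ring

lemma sum_mul_gsoCoord {d : ℕ} (x y : ℕ → ℝ) {j k : ℕ} (hjk : j < k) (hk : k ≤ d) :
    ∑ i ∈ Finset.range (d + 1),
      (if i = k ∧ k < d then x k else if i = d then y k else 0) * gsoCoord d x y j i =
      y k * (y j / gsoK x y j) := by
  rw [Finset.sum_range_succ, Finset.sum_eq_zero, zero_add, if_neg (by omega), if_pos rfl,
    gsoCoord, if_neg (by omega), if_pos rfl]
  intro i hi
  have hi := Finset.mem_range.1 hi
  by_cases hik : i = k
  · have hcoord : gsoCoord d x y j i = 0 := by
      rw [gsoCoord, if_neg (by omega), if_neg (by omega), if_neg (by omega)]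
    rw [hcoord, mul_zero]
  · rw [if_neg (by omega), if_neg (by omega), zero_mul]

lemma sum_smul_gsoCoord {d : ℕ} {x y : ℕ → ℝ} (hx : ∀ i < d, x i ≠ 0) (i : ℕ) :
    ∀ n ≤ d, ∑ j ∈ Finset.range n, y j / (x j ^ 2 * gsoK x y (j + 1)) * gsoCoord d x y j i =
      if i < n then y i / x i / gsoK x y n
      else if i = d then 1 - 1 / gsoK x y n else 0 := by
  intro n
  induction n with
  | zero => simp [gsoK]
  | succ n ih =>
    intro hn
    have hxn := hx n hn
    have hK := (gsoK_pos x y n).ne'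
    have hK' := (gsoK_pos x y (n + 1)).ne'
    have hsucc : gsoK x y (n + 1) * x n ^ 2 = gsoK x y n * x n ^ 2 + y n ^ 2 := by
      rw [gsoK_succ]
      field_simp
    rw [Finset.sum_range_succ, ih (by omega), gsoCoord]
    rcases lt_trichotomy i n with h | h | h
    · have hxi := hx i (by omega)
      rw [if_pos h, if_pos h, if_pos (by omega)]
      field_simp
      linear_combination y i * hsucc
    · subst h
      rw [if_neg (by omega), if_neg (by omega), if_neg (by omega), if_neg (by omega),
        if_pos rfl, if_pos (by omega)]
      field_simp
      ring
    · have h₁ : ¬ i < n := by omega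
      have h₂ : ¬ i < n + 1 := by omega
      by_cases hid : i = d
      · simp only [if_neg h₁, if_neg h₂, if_pos hid]
        field_simp
        linear_combination -hsucc
      · simp only [if_neg h₁, if_neg h₂, if_neg hid, if_neg h.ne', mul_zero, add_zero]

lemma sub_sum_smul_gsoCoord {d : ℕ} {x y : ℕ → ℝ} (hx : ∀ i < d, x i ≠ 0) {k : ℕ} (hk : k ≤ d)
    (i : ℕ) :
    (if i = k ∧ k < d then x k else if i = d then y k else 0) -
      y k * ∑ j ∈ Finset.range k, y j / (x j ^ 2 * gsoK x y (j + 1)) * gsoCoord d x y j i =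
      gsoCoord d x y k i := by
  rw [sum_smul_gsoCoord hx i k hk, gsoCoord]
  split_ifs <;> first | omega | ring

lemma gramSchmidt_apply_eq_gsoCoord {d : ℕ} {x y : ℕ → ℝ} (hx : ∀ i < d, x i ≠ 0)
    {v gs : Fin (d + 1) → EuclideanSpace ℝ (Fin (d + 1))}
    (hv : ∀ (j i : Fin (d + 1)), v j i =
      if (i : ℕ) = (j : ℕ) ∧ (j : ℕ) < d then x (j : ℕ)
      else if (i : ℕ) = d then y (j : ℕ) else 0)
    (hgs : ∀ k, gs k = v k - ∑ j ∈ Finset.Iio k, (⟪v k, gs j⟫ / ⟪gs j, gs j⟫) • gs j)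
    (k : Fin (d + 1)) : ∀ i : Fin (d + 1), gs k i = gsoCoord d x y k i := by
  induction k using WellFoundedLT.induction with
  | ind k ih =>
    intro i
    have coeff_mul : ∀ j ∈ Finset.Iio k, ⟪v k, gs j⟫ / ⟪gs j, gs j⟫ * gs j i =
        y k * (y j / (x j ^ 2 * gsoK x y (j + 1)) * gsoCoord d x y j i) := by
      intro j hj
      have hjk : j < k := Finset.mem_Iio.1 hj
      have hjk' : (j : ℕ) < k := hjk
      have hjd : (j : ℕ) < d := by omega
      have hxj := hx j hjd
      have h₁ : ⟪v k, gs j⟫ = y k * (y j / gsoK x y j) := by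
        rw [← sum_mul_gsoCoord x y hjk' (Nat.lt_succ_iff.1 k.2), Finset.sum_range, real_inner_comm,
          PiLp.inner_apply]
        exact Finset.sum_congr rfl fun l _ => by simp [hv, ih j hjk]
      have h₂ : ⟪gs j, gs j⟫ = x j ^ 2 * gsoK x y (j + 1) / gsoK x y j := by
        rw [← sum_gsoCoord_sq x y hjd hxj, Finset.sum_range, PiLp.inner_apply]
        exact Finset.sum_congr rfl fun l _ => by simp [ih j hjk, sq]
      have hK := (gsoK_pos x y j).ne'
      have hK' := (gsoK_pos x y (j + 1)).ne'
      rw [h₁, h₂, ih j hjk]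
      field_simp
    rw [hgs k, ← sub_sum_smul_gsoCoord hx (Nat.lt_succ_iff.1 k.2) i, PiLp.sub_apply, hv,
      WithLp.ofLp_sum, Finset.sum_apply]
    simp only [PiLp.smul_apply, smul_eq_mul]
    rw [Finset.sum_congr rfl coeff_mul, ← Finset.mul_sum, ← Nat.Iio_eq_range,
      ← Fin.map_valEmbedding_Iio, Finset.sum_map]
    rfl

/-- Lemma `gsouse`, part (gsv): explicit Gram–Schmidt orthogonalization of the columns
`v_i = x_i·e_i + y_i·e_{d+1}` (for `i ≤ d`) and `v_{d+1} = y_{d+1}·e_{d+1}`. -/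
theorem gso_identity_with_extra_row_coords
    (d : ℕ) (hd : 1 ≤ d) (x y : ℕ → ℝ)
    (hx : ∀ i < d, x i ≠ 0) (hy : y d ≠ 0)
    (v : Fin (d + 1) → EuclideanSpace ℝ (Fin (d + 1)))
    (hv : ∀ (j i : Fin (d + 1)), v j i =
      if (i : ℕ) = (j : ℕ) ∧ (j : ℕ) < d then x (j : ℕ)
      else if (i : ℕ) = d then y (j : ℕ) else 0)
    (gs : Fin (d + 1) → EuclideanSpace ℝ (Fin (d + 1)))
    (hgs : ∀ k, gs k = v k - ∑ j ∈ Finset.Iio k, (⟪v k, gs j⟫ / ⟪gs j, gs j⟫) • gs j)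
    (K : ℕ → ℝ)
    (hK : ∀ j, K j = 1 + ∑ i ∈ Finset.range j, (y i / x i) ^ 2) :
    ∀ (k i : Fin (d + 1)),
      ((i : ℕ) < (k : ℕ) → gs k i = -(y (k : ℕ) / K (k : ℕ)) * (y (i : ℕ) / x (i : ℕ))) ∧
      ((i : ℕ) = (k : ℕ) ∧ (k : ℕ) < d → gs k i = x (k : ℕ)) ∧
      ((k : ℕ) < (i : ℕ) ∧ (i : ℕ) < d → gs k i = 0) ∧
      ((i : ℕ) = d → gs k i = y (k : ℕ) / K (k : ℕ)) := by
  intro k i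
  have hKk : K k = gsoK x y k := hK k
  rw [gramSchmidt_apply_eq_gsoCoord hx hv hgs k i, gsoCoord, hKk]
  refine ⟨fun h => if_pos h, fun h => ?_, fun h => ?_, fun h => ?_⟩
  · rw [if_neg (by omega), if_neg (by omega), if_pos h.1]
  · rw [if_neg (by omega), if_neg (by omega), if_neg (by omega)]
  · rw [if_neg (by omega), if_pos h]
end

section
/- Let d ≥ 1, let x_1,…,x_d be nonzero real numbers and y_1,…,y_{d+1} real numbers with y_{d+1} ≠ 0, and let v_1,…,v_{d+1} ∈ ℝ^{d+1} be defined by v_i = x_i·e_i + y_i·e_{d+1} for 1 ≤ i ≤ d and v_{d+1} = y_{d+1}·e_{d+1}. Set K_0 = 1 and K_j = 1 + ∑_{i=1}^j (y_i/x_i)² for 1 ≤ j ≤ d, and let v_1^⋆,…,v_{d+1}^⋆ be the Gram–Schmidt orthogonalization of v_1,…,v_{d+1}. Then for 1 ≤ k ≤ d the squared Euclidean norm ‖v_k^⋆‖² equals x_k²·K_k/K_{k−1}, and ‖v_{d+1}^⋆‖² = y_{d+1}²/K_d. -/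
open Finset RealInnerProductSpace

section GramSchmidtExtraRow

variable {E : Type*} [NormedAddCommGroup E]

/-- The squared norm of `extraRowVec z y f m` when `f` is a unit vector and the `z i` are
orthogonal to each other and to `f`. -/
noncomputable def extraRowNormSq (z : ℕ → E) (y : ℕ → ℝ) (m : ℕ) : ℝ :=
  1 + ∑ i ∈ range m, y i ^ 2 / ‖z i‖ ^ 2

lemma extraRowNormSq_pos (z : ℕ → E) (y : ℕ → ℝ) (m : ℕ) : 0 < extraRowNormSq z y m := by
  unfold extraRowNormSq; positivity

lemma extraRowNormSq_succ (z : ℕ → E) (y : ℕ → ℝ) (m : ℕ) :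
    extraRowNormSq z y (m + 1) = extraRowNormSq z y m + y m ^ 2 / ‖z m‖ ^ 2 := by
  rw [extraRowNormSq, extraRowNormSq, sum_range_succ, add_assoc]

variable [InnerProductSpace ℝ E]

/-- The vector `f` corrected so as to be orthogonal to `z i + y i • f` for all `i < m`. -/
noncomputable def extraRowVec (z : ℕ → E) (y : ℕ → ℝ) (f : E) (m : ℕ) : E :=
  f - ∑ i ∈ range m, (y i / ‖z i‖ ^ 2) • z i

lemma inner_extraRowVec_of_le {z : ℕ → E} {f : E} (y : ℕ → ℝ)
    (hz : Pairwise fun i j => ⟪z i, z j⟫ = 0) (hzf : ∀ i, ⟪z i, f⟫ = 0) {m k : ℕ} (hmk : m ≤ k) :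
    ⟪z k, extraRowVec z y f m⟫ = 0 := by
  rw [extraRowVec, inner_sub_right, hzf, inner_sum, sum_eq_zero, sub_zero]
  intro i hi
  have : k ≠ i := by have := mem_range.1 hi; omega
  rw [real_inner_smul_right, hz this, mul_zero]

lemma inner_left_extraRowVec {z : ℕ → E} {f : E} (y : ℕ → ℝ) (hf : ‖f‖ = 1)
    (hzf : ∀ i, ⟪z i, f⟫ = 0) (m : ℕ) : ⟪f, extraRowVec z y f m⟫ = 1 := by
  rw [extraRowVec, inner_sub_right, real_inner_self_eq_norm_sq, hf, inner_sum, sum_eq_zero]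
  · norm_num
  · intro i _
    rw [real_inner_smul_right, real_inner_comm, hzf, mul_zero]

lemma extraRowVec_succ (z : ℕ → E) (y : ℕ → ℝ) (f : E) (m : ℕ) :
    extraRowVec z y f (m + 1) = extraRowVec z y f m - (y m / ‖z m‖ ^ 2) • z m := by
  rw [extraRowVec, extraRowVec, sum_range_succ, sub_add_eq_sub_sub]

lemma inner_extraRowVec_self {z : ℕ → E} {f : E} (y : ℕ → ℝ) (hf : ‖f‖ = 1)
    (hz : Pairwise fun i j => ⟪z i, z j⟫ = 0) (hzf : ∀ i, ⟪z i, f⟫ = 0) (m : ℕ) :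
    ⟪extraRowVec z y f m, extraRowVec z y f m⟫ = extraRowNormSq z y m := by
  induction m with
  | zero => simp [extraRowVec, extraRowNormSq, hf]
  | succ m ih =>
    have h := inner_extraRowVec_of_le y hz hzf (le_refl m)
    have h' : ⟪extraRowVec z y f m, z m⟫ = 0 := by rw [real_inner_comm, h]
    rw [extraRowVec_succ, extraRowNormSq_succ, inner_sub_left, inner_sub_right, inner_sub_right, ih]
    simp only [real_inner_smul_left, real_inner_smul_right, h, h']
    rw [real_inner_self_eq_norm_sq]
    by_cases h0 : ‖z m‖ = 0
    · simp [h0]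
    · field_simp
      ring

lemma inner_self_add_smul_extraRowVec {z : ℕ → E} {f : E} (y : ℕ → ℝ) (hf : ‖f‖ = 1)
    (hz : Pairwise fun i j => ⟪z i, z j⟫ = 0) (hzf : ∀ i, ⟪z i, f⟫ = 0) (k : ℕ) :
    ⟪z k + (y k / extraRowNormSq z y k) • extraRowVec z y f k,
      z k + (y k / extraRowNormSq z y k) • extraRowVec z y f k⟫ =
      ‖z k‖ ^ 2 + y k ^ 2 / extraRowNormSq z y k := by
  have h := inner_extraRowVec_of_le y hz hzf (le_refl k)
  have h' : ⟪extraRowVec z y f k, z k⟫ = 0 := by rw [real_inner_comm, h]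
  have hK := (extraRowNormSq_pos z y k).ne'
  simp only [inner_add_left, inner_add_right, real_inner_smul_left, real_inner_smul_right, h, h']
  rw [inner_extraRowVec_self y hf hz hzf, real_inner_self_eq_norm_sq]
  field_simp
  ring

/-- Gram–Schmidt orthogonalization of the vectors `z k + y k • f`, `k ≤ d`, in closed form. -/
lemma gramSchmidt_add_smul_eq {z : ℕ → E} {f : E} (y : ℕ → ℝ) (hf : ‖f‖ = 1)
    (hz : Pairwise fun i j => ⟪z i, z j⟫ = 0) (hzf : ∀ i, ⟪z i, f⟫ = 0) {d : ℕ}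
    (hz0 : ∀ i < d, z i ≠ 0) {g : ℕ → E}
    (hg : ∀ k ≤ d, g k = z k + y k • f -
      ∑ j ∈ range k, (⟪z k + y k • f, g j⟫ / ⟪g j, g j⟫) • g j) :
    ∀ k ≤ d, g k = z k + (y k / extraRowNormSq z y k) • extraRowVec z y f k := by
  intro k
  induction k using Nat.strong_induction_on with
  | _ k ih =>
    intro hk
    have key : ∀ j ∈ range k, (⟪z k + y k • f, g j⟫ / ⟪g j, g j⟫) • g j =
        -((y k / extraRowNormSq z y (j + 1)) • extraRowVec z y f (j + 1) -
          (y k / extraRowNormSq z y j) • extraRowVec z y f j) := by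
      intro j hj
      have hjk := mem_range.1 hj
      have hn : ‖z j‖ ≠ 0 := norm_ne_zero_iff.2 (hz0 j (by omega))
      have hK := (extraRowNormSq_pos z y j).ne'
      have hK' := (extraRowNormSq_pos z y (j + 1)).ne'
      have hin : ⟪z k + y k • f, g j⟫ = y k * y j / extraRowNormSq z y j := by
        rw [ih j hjk (by omega)]
        simp only [inner_add_left, inner_add_right, real_inner_smul_left, real_inner_smul_right,
          hz hjk.ne', inner_extraRowVec_of_le y hz hzf hjk.le, real_inner_comm (z j) f, hzf,
          inner_left_extraRowVec y hf hzf]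
        ring
      have hself : ⟪g j, g j⟫ =
          ‖z j‖ ^ 2 * extraRowNormSq z y (j + 1) / extraRowNormSq z y j := by
        rw [ih j hjk (by omega), inner_self_add_smul_extraRowVec y hf hz hzf,
          extraRowNormSq_succ]
        field_simp
      rw [hin, hself, ih j hjk (by omega), extraRowVec_succ]
      match_scalars
      · field_simp
      · have hs : ‖z j‖ ^ 2 * extraRowNormSq z y (j + 1) =
            ‖z j‖ ^ 2 * extraRowNormSq z y j + y j ^ 2 := by
          rw [extraRowNormSq_succ]
          field_simp
        field_simp
        linear_combination (-y k) * hs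
    rw [hg k hk, sum_congr rfl key, sum_neg_distrib,
      sum_range_sub (fun j => (y k / extraRowNormSq z y j) • extraRowVec z y f j)]
    simp only [extraRowVec, extraRowNormSq, range_zero, sum_empty]
    module

end GramSchmidtExtraRow

/-- Lemma `gsouse`, part (enorm): squared Euclidean norms of the Gram–Schmidt vectors,
`‖v_k⋆‖² = x_k² K_k / K_{k−1}` for `k ≤ d`, and `‖v_{d+1}⋆‖² = y_{d+1}² / K_d`. -/
theorem gso_identity_with_extra_row_norms
    (d : ℕ) (hd : 1 ≤ d) (x y : ℕ → ℝ)
    (hx : ∀ i < d, x i ≠ 0) (hy : y d ≠ 0)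
    (v : Fin (d + 1) → EuclideanSpace ℝ (Fin (d + 1)))
    (hv : ∀ (j i : Fin (d + 1)), v j i =
      if (i : ℕ) = (j : ℕ) ∧ (j : ℕ) < d then x (j : ℕ)
      else if (i : ℕ) = d then y (j : ℕ) else 0)
    (gs : Fin (d + 1) → EuclideanSpace ℝ (Fin (d + 1)))
    (hgs : ∀ k, gs k = v k - ∑ j ∈ Finset.Iio k, (⟪v k, gs j⟫ / ⟪gs j, gs j⟫) • gs j)
    (K : ℕ → ℝ)
    (hK : ∀ j, K j = 1 + ∑ i ∈ Finset.range j, (y i / x i) ^ 2) :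
    ∀ k : Fin (d + 1),
      ((k : ℕ) < d → ‖gs k‖ ^ 2 = x (k : ℕ) ^ 2 * K ((k : ℕ) + 1) / K (k : ℕ)) ∧
      ((k : ℕ) = d → ‖gs k‖ ^ 2 = y d ^ 2 / K d) := by
  set f : EuclideanSpace ℝ (Fin (d + 1)) := EuclideanSpace.single (Fin.last d) 1 with hf_def
  set z : ℕ → EuclideanSpace ℝ (Fin (d + 1)) := fun i =>
    if h : i < d then EuclideanSpace.single ⟨i, by omega⟩ (x i) else 0 with hz_def
  set g : ℕ → EuclideanSpace ℝ (Fin (d + 1)) := fun i =>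
    if h : i < d + 1 then gs ⟨i, h⟩ else 0
  have hgs_eq : ∀ k : Fin (d + 1), g k = gs k := fun k => dif_pos k.isLt
  have hf : ‖f‖ = 1 := by simp [hf_def]
  have hz : Pairwise fun i j => ⟪z i, z j⟫ = 0 := by
    intro i j hij
    by_cases hi : i < d <;> by_cases hj : j < d <;>
      simp [hz_def, hi, hj, hij, EuclideanSpace.inner_single_left]
  have hzf : ∀ i, ⟪z i, f⟫ = 0 := by
    intro i
    by_cases hi : i < d
    · simp [hz_def, hf_def, hi, EuclideanSpace.inner_single_left, Fin.ext_iff, hi.ne]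
    · simp [hz_def, hi]
  have hnorm : ∀ i < d, ‖z i‖ ^ 2 = x i ^ 2 := fun i hi => by simp [hz_def, hi]
  have hz0 : ∀ i < d, z i ≠ 0 := fun i hi => by simp [hz_def, hi, hx i hi]
  have hvz : ∀ k : Fin (d + 1), v k = z k + y k • f := by
    intro k
    ext i
    have hzi : z k i = if (i : ℕ) = k ∧ (k : ℕ) < d then x k else 0 := by
      by_cases hkd : (k : ℕ) < d <;> simp [hz_def, hkd, Fin.ext_iff]
    have hfi : f i = if (i : ℕ) = d then 1 else 0 := by
      simp [hf_def, Fin.ext_iff]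
    rw [hv, PiLp.add_apply, PiLp.smul_apply, hzi, hfi]
    split_ifs <;> first | omega | simp
  have hKeq : ∀ m ≤ d, extraRowNormSq z y m = K m := by
    intro m hm
    rw [hK, extraRowNormSq]
    congr 1
    refine sum_congr rfl fun i hi => ?_
    rw [hnorm i (by have := mem_range.1 hi; omega), div_pow]
  have hg : ∀ k ≤ d, g k = z k + y k • f -
      ∑ j ∈ range k, (⟪z k + y k • f, g j⟫ / ⟪g j, g j⟫) • g j := by
    intro k hk
    obtain ⟨k, rfl⟩ : ∃ k' : Fin (d + 1), (k' : ℕ) = k := ⟨⟨k, by omega⟩, rfl⟩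
    rw [← hvz, hgs_eq, hgs k, ← Nat.Iio_eq_range, ← Fin.map_valEmbedding_Iio, sum_map]
    simp only [Fin.valEmbedding_apply, hgs_eq]
  intro k
  have hk : (k : ℕ) ≤ d := by omega
  have hnsq : ‖gs k‖ ^ 2 = ‖z k‖ ^ 2 + y k ^ 2 / K k := by
    rw [← real_inner_self_eq_norm_sq, ← hgs_eq, gramSchmidt_add_smul_eq y hf hz hzf hz0 hg k hk,
      inner_self_add_smul_extraRowVec y hf hz hzf, hKeq k hk]
  have hKpos : K k ≠ 0 := hKeq k hk ▸ (extraRowNormSq_pos z y k).ne'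
  refine ⟨fun hkd => ?_, fun hkd => ?_⟩
  · have hxk := hx k hkd
    rw [hnsq, hnorm k hkd, ← hKeq (k + 1) hkd, extraRowNormSq_succ, hKeq k hk, hnorm k hkd]
    field_simp
  · rw [hnsq, hkd]
    simp [hz_def]
end

section
/- For every real number C > 1, one has ((C−1)/(C+1))^{(C−1)/2} · (2/(C+1)) ≤ 1/C. -/
/-- For every real `C > 1`, `((C−1)/(C+1))^{(C−1)/2} · (2/(C+1)) ≤ 1/C`. -/
theorem rpow_bound (C : ℝ) (hC : 1 < C) :
    ((C - 1) / (C + 1)) ^ ((C - 1) / 2) * (2 / (C + 1)) ≤ 1 / C := by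
  have hC0 : 0 < C := by linarith
  have hC1 : 0 < C + 1 := by linarith
  have hx : 0 < (C - 1) / (C + 1) := div_pos (by linarith) hC1
  have hpow : ((C - 1) / (C + 1)) ^ ((C - 1) / 2) ≤ Real.exp (-((C - 1) / (C + 1))) := by
    rw [Real.rpow_def_of_pos hx, Real.exp_le_exp]
    calc Real.log ((C - 1) / (C + 1)) * ((C - 1) / 2)
        ≤ ((C - 1) / (C + 1) - 1) * ((C - 1) / 2) :=
          mul_le_mul_of_nonneg_right (Real.log_le_sub_one_of_pos hx) (by linarith)
      _ = -((C - 1) / (C + 1)) := by field_simp; ring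
  have hexp : Real.exp (-((C - 1) / (C + 1))) ≤ ((C - 1) / (C + 1) + 1)⁻¹ := by
    rw [Real.exp_neg]
    exact inv_anti₀ (by linarith) (Real.add_one_le_exp _)
  calc ((C - 1) / (C + 1)) ^ ((C - 1) / 2) * (2 / (C + 1))
      ≤ ((C - 1) / (C + 1) + 1)⁻¹ * (2 / (C + 1)) :=
        mul_le_mul_of_nonneg_right (hpow.trans hexp) (by positivity)
    _ = 1 / C := by
        have h : (C - 1) / (C + 1) + 1 = 2 * C / (C + 1) := by field_simp; ring
        rw [h]
        field_simp
end

section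
/- The function f : (1,∞) → ℝ defined by f(x) = ((x−1)/(x+1))^{(x−1)/2} · (2x/(x+1)) is strictly monotonically decreasing on (1,∞). -/
open Real in
/-- The inequality `t < artanh t` at `t = 1 / x`. -/
lemma log_sub_one_sub_log_add_one_lt {x : ℝ} (hx : 1 < x) :
    log (x - 1) - log (x + 1) < -(2 / x) := by
  have h1 : 0 < x - 1 := by linarith
  have h := lt_log_one_add_of_pos (div_pos two_pos h1)
  have e1 : 1 + 2 / (x - 1) = (x + 1) / (x - 1) := by field_simp; ring
  have e2 : 2 * (2 / (x - 1)) / (2 / (x - 1) + 2) = 2 / x := by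
    have : 2 / (x - 1) + 2 = 2 * x / (x - 1) := by field_simp; ring
    rw [this]
    field_simp
  rw [e2, e1, log_div (by linarith) h1.ne'] at h
  linarith

open Real Set in
lemma strictAntiOn_log_aux :
    StrictAntiOn (fun x : ℝ => (x - 1) / 2 * (log (x - 1) - log (x + 1)) +
      (log x - log (x + 1))) (Ioi 1) := by
  have hderiv : ∀ x ∈ Ioi (1 : ℝ), HasDerivAt
      (fun x : ℝ => (x - 1) / 2 * (log (x - 1) - log (x + 1)) + (log x - log (x + 1)))
      ((log (x - 1) - log (x + 1)) / 2 + 1 / x) x := by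
    intro x (hx : 1 < x)
    have h1 : x - 1 ≠ 0 := by linarith
    have h2 : x + 1 ≠ 0 := by linarith
    have h3 : x ≠ 0 := by linarith
    have hid := hasDerivAt_id' x
    have d1 := (hid.sub_const 1).log h1
    have d2 := (hid.add_const 1).log h2
    refine ((((hid.sub_const 1).div_const 2).mul (d1.sub d2)).add
      ((hid.log h3).sub d2)).congr_deriv ?_
    simp only [Pi.sub_apply]
    field_simp
    ring
  refine strictAntiOn_of_deriv_neg (convex_Ioi 1)
    (fun x hx => (hderiv x hx).continuousAt.continuousWithinAt) fun x hx => ?_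
  rw [interior_Ioi] at hx
  rw [(hderiv x hx).deriv]
  have h := log_sub_one_sub_log_add_one_lt hx
  have : 2 / x = 2 * (1 / x) := by ring
  linarith

/-- The function `f(x) = ((x−1)/(x+1))^{(x−1)/2} · (2x/(x+1))` is strictly monotonically
decreasing on `(1, ∞)`. -/
theorem strictAntiOn_rpow_aux :
    StrictAntiOn (fun x : ℝ => ((x - 1) / (x + 1)) ^ ((x - 1) / 2) * (2 * x / (x + 1)))
      (Set.Ioi (1 : ℝ)) := by
  have key : Set.EqOn (fun x : ℝ => 2 * Real.exp ((x - 1) / 2 *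
        (Real.log (x - 1) - Real.log (x + 1)) + (Real.log x - Real.log (x + 1))))
      (fun x : ℝ => ((x - 1) / (x + 1)) ^ ((x - 1) / 2) * (2 * x / (x + 1))) (Set.Ioi 1) := by
    intro x (hx : 1 < x)
    have h1 : 0 < x - 1 := by linarith
    have h2 : 0 < x + 1 := by linarith
    have h3 : 0 < x := by linarith
    simp only
    rw [Real.rpow_def_of_pos (div_pos h1 h2), Real.log_div h1.ne' h2.ne', Real.exp_add,
      Real.exp_sub, Real.exp_log h3, Real.exp_log h2, mul_comm ((x - 1) / 2)]
    ring
  refine StrictAntiOn.congr (fun x hx y hy hxy => ?_) key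
  exact mul_lt_mul_of_pos_left (Real.exp_lt_exp.2 (strictAntiOn_log_aux hx hy hxy)) two_pos
end

section
/- Let d ≥ 1, let p_1 < … < p_d be the first d prime numbers, let N ≥ 2 be an integer, let C > 0 be real, and let A_1 be Adleman's 1-norm Prime Number Lattice basis matrix. Let z ∈ ℤ^{d+1} have strictly negative last coordinate, set γ = |z_{d+1}|, u = ∏_{1≤i≤d, z_i>0} p_i^{z_i} and k = ∏_{1≤i≤d, z_i<0} p_i^{−z_i}. Then ‖A_1 z‖_1 = ln u + ln k + C·|ln u − ln(k·N^γ)|. -/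
open Finset Matrix

theorem log_natCast_prod_ite_pow {ι : Type*} (s : Finset ι) (c : ι → Prop) [DecidablePred c]
    (q e : ι → ℕ) (hq : ∀ i, q i ≠ 0) :
    Real.log ((∏ i ∈ s, if c i then q i ^ e i else 1 : ℕ) : ℝ) =
      ∑ i ∈ s, if c i then (e i : ℝ) * Real.log (q i) else 0 := by
  rw [Nat.cast_prod, Real.log_prod]
  · refine Finset.sum_congr rfl fun i _ => ?_
    split_ifs <;> simp
  · intro i _
    split_ifs <;> simp [hq i]

theorem Int.cast_toNat_of_nonneg {R : Type*} [Ring R] {a : ℤ} (ha : 0 ≤ a) :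
    (a.toNat : R) = a := by
  rw [← Int.cast_natCast, Int.toNat_of_nonneg ha]

/-- The 1-norm of `A₁ z` equals `ln u + ln k + C·|ln u − ln(k N^γ)|` for the candidate
solution `(u, k, γ)` associated to a vector `z` with strictly negative last coordinate. -/
theorem adleman_one_norm_eq
    (d : ℕ) (hd : 1 ≤ d) (N : ℕ) (hN : 2 ≤ N) (C : ℝ) (hC : 0 < C)
    (A : Matrix (Fin (d + 1)) (Fin (d + 1)) ℝ)
    (hA : ∀ i j, A i j =
      if (i : ℕ) = d then
        (if (j : ℕ) = d then C * Real.log N else C * Real.log (Nat.nth Nat.Prime (j : ℕ)))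
      else if (i : ℕ) = (j : ℕ) then Real.log (Nat.nth Nat.Prime (j : ℕ)) else 0)
    (z : Fin (d + 1) → ℤ) (hz : z (Fin.last d) < 0)
    (γ : ℕ) (hγ : γ = (z (Fin.last d)).natAbs)
    (u : ℕ) (hu : u = ∏ i : Fin d,
      if 0 < z i.castSucc then Nat.nth Nat.Prime (i : ℕ) ^ (z i.castSucc).toNat else 1)
    (k : ℕ) (hk : k = ∏ i : Fin d,
      if z i.castSucc < 0 then Nat.nth Nat.Prime (i : ℕ) ^ (-z i.castSucc).toNat else 1) :
    ∑ i, |A.mulVec (fun j => (z j : ℝ)) i| =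
      Real.log u + Real.log k + C * |Real.log u - Real.log (k * (N : ℝ) ^ γ)| := by
  subst hu hk hγ
  have hq : ∀ i : Fin d, Nat.nth Nat.Prime (i : ℕ) ≠ 0 := fun i => (Nat.prime_nth_prime i).ne_zero
  have hlog : ∀ i : Fin d, 0 ≤ Real.log (Nat.nth Nat.Prime (i : ℕ)) := fun i =>
    Real.log_natCast_nonneg _
  have hu := log_natCast_prod_ite_pow Finset.univ (fun i : Fin d => 0 < z i.castSucc)
    (fun i => Nat.nth Nat.Prime (i : ℕ)) (fun i => (z i.castSucc).toNat) hq
  have hk := log_natCast_prod_ite_pow Finset.univ (fun i : Fin d => z i.castSucc < 0)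
    (fun i => Nat.nth Nat.Prime (i : ℕ)) (fun i => (-z i.castSucc).toNat) hq
  have hk0 : ((∏ i : Fin d, if z i.castSucc < 0 then
      Nat.nth Nat.Prime (i : ℕ) ^ (-z i.castSucc).toNat else 1 : ℕ) : ℝ) ≠ 0 := by
    rw [Nat.cast_ne_zero, Finset.prod_ne_zero_iff]
    intro i _
    split_ifs <;> simp [hq i]
  have hN0 : (N : ℝ) ^ (z (Fin.last d)).natAbs ≠ 0 := pow_ne_zero _ (by positivity)
  have hγ : ((z (Fin.last d)).natAbs : ℝ) = -(z (Fin.last d) : ℝ) := by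
    rw [Nat.cast_natAbs, abs_of_neg hz, Int.cast_neg]
  have habs : ∀ i : Fin d, |A.mulVec (fun j => (z j : ℝ)) i.castSucc| =
      |(z i.castSucc : ℝ)| * Real.log (Nat.nth Nat.Prime (i : ℕ)) := by
    intro i
    have hrow : A.mulVec (fun j => (z j : ℝ)) i.castSucc =
        Real.log (Nat.nth Nat.Prime (i : ℕ)) * z i.castSucc := by
      rw [Matrix.mulVec, dotProduct, Finset.sum_eq_single i.castSucc]
      · simp [hA, i.isLt.ne]
      · intro j _ hj
        have hij : (i : ℕ) ≠ j := fun h => hj (Fin.ext h.symm)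
        simp [hA, i.isLt.ne, hij]
      · simp
    rw [hrow, abs_mul, abs_of_nonneg (hlog i), mul_comm]
  have hlast : A.mulVec (fun j => (z j : ℝ)) (Fin.last d) =
      C * (∑ i : Fin d, (z i.castSucc : ℝ) * Real.log (Nat.nth Nat.Prime (i : ℕ)) +
        z (Fin.last d) * Real.log N) := by
    rw [Matrix.mulVec, dotProduct, Fin.sum_univ_castSucc, mul_add, Finset.mul_sum]
    congr 1
    · refine Finset.sum_congr rfl fun i _ => ?_
      simp only [hA, Fin.val_last, Fin.val_castSucc, i.isLt.ne, if_true, if_false]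
      ring
    · simp only [hA, Fin.val_last, if_true]
      ring
  rw [Fin.sum_univ_castSucc, hlast, Real.log_mul hk0 hN0, Real.log_pow, hγ, hu, hk, abs_mul,
    abs_of_pos hC, ← Finset.sum_add_distrib]
  congr 1
  · refine Finset.sum_congr rfl fun i _ => ?_
    rw [habs]
    rcases lt_trichotomy (z i.castSucc) 0 with h | h | h
    · rw [if_neg h.not_gt, if_pos h, Int.cast_toNat_of_nonneg (by omega), zero_add,
        abs_of_neg (by exact_mod_cast h), Int.cast_neg]
    · simp [h]
    · rw [if_pos h, if_neg h.not_gt, Int.cast_toNat_of_nonneg h.le, add_zero,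
        abs_of_pos (by exact_mod_cast h)]
  · rw [← sub_sub, ← Finset.sum_sub_distrib, neg_mul, sub_neg_eq_add]
    congr 3
    refine Finset.sum_congr rfl fun i _ => ?_
    rcases lt_trichotomy (z i.castSucc) 0 with h | h | h
    · rw [if_neg h.not_gt, if_pos h, Int.cast_toNat_of_nonneg (by omega), Int.cast_neg]
      ring
    · simp [h]
    · rw [if_pos h, if_neg h.not_gt, Int.cast_toNat_of_nonneg h.le, sub_zero]
end
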